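/- Let A = Â₁ × ⋯ × Â_r × Ã be a product of H-basic algebras, where Â₁,...,Â_r have Kemer index p and semisimple parts among a fixed list R₁,...,R_t of H-semisimple algebras, and Ã is a product of H-basic algebras of index less than p. For j = 1,...,t define C_j = (R_j ∗ F^H⟨x₁,...,x_s⟩)/(id^H_{R_j ∗ F^H⟨x⟩}(A) + ⟨X⟩_H^s) where s−1 bounds the nilpotency indices, and set C = C₁ × ⋯ × C_t. Then id^H(C × Ã) = id^H(A). -/

import Mathlib

noncomputable section
open TensorProduct

/-! ## The free `H`-module algebra -/

variable (F : Type) [Field F] (H : Type) [Ring H] [Algebra F H]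

/-- The free `H`-module algebra `F^H⟨X⟩` on a set of variables `V`:
the tensor algebra on `F X ⊗ H`. -/
abbrev FreeHMA (V : Type) : Type := TensorAlgebra F ((V →₀ F) ⊗[F] H)

variable {V : Type}

/-- The variable `x_v^h`. -/
def xvar (v : V) (h : H) : FreeHMA F H V :=
  TensorAlgebra.ι F (Finsupp.single v 1 ⊗ₜ[F] h)

/-- The algebra endomorphism of the free `H`-module algebra induced by a linear
substitution of the variables (not touching the `H`-labels). -/
def substHom (g : V → (V →₀ F)) : FreeHMA F H V →ₐ[F] FreeHMA F H V :=
  TensorAlgebra.lift F ((TensorAlgebra.ι F).comp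
    (LinearMap.rTensor H (Finsupp.linearCombination F g)))

/-- `f|_{x_i ↔ x_j}` : swapping two variables. -/
def swapSubst [DecidableEq V] (i j : V) : FreeHMA F H V →ₐ[F] FreeHMA F H V :=
  substHom F H (fun v => Finsupp.single (Equiv.swap i j v) 1)

/-- `f|_{x_i → x_j}` : substituting `x_j` for `x_i`. -/
def renameSubst [DecidableEq V] (i j : V) : FreeHMA F H V →ₐ[F] FreeHMA F H V :=
  substHom F H (Function.update (fun v => Finsupp.single v 1) i (Finsupp.single j 1))

/-- `f` is alternating on the set of variables `X`. -/
def AlternatingOn [DecidableEq V] (X : Finset V) (f : FreeHMA F H V) : Prop :=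
  ∀ i ∈ X, ∀ j ∈ X, i ≠ j → swapSubst F H i j f = -f

/-- `f` involves only variables from `T`. -/
def DependsOnlyOn (f : FreeHMA F H V) (T : Set V) : Prop :=
  f ∈ Algebra.adjoin F {x : FreeHMA F H V | ∃ v ∈ T, ∃ h : H, x = xvar F H v h}

/-- `f` is a multilinear `H`-polynomial in the variables of `supp` (and involves no
other variables): substituting `α x_i + y` for `x_i` (`y` a fresh variable) gives
`α f + f|_{x_i → y}`. -/
def MultilinearOn [DecidableEq V] (supp S : Finset V) (f : FreeHMA F H V) : Prop :=
  DependsOnlyOn F H f ↑supp ∧ S ⊆ supp ∧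
  ∀ i ∈ S, ∀ y, y ∉ supp → ∀ α : F,
    substHom F H (Function.update (fun v => Finsupp.single v 1) i
        (α • Finsupp.single i 1 + Finsupp.single y 1)) f
      = α • f + renameSubst F H i y f

/-! ## `H`-module algebras -/

variable [Coalgebra F H]

/-- An `H`-module algebra structure on an `F`-algebra `A`: an `H`-action by linear maps
such that `h·(ab) = (h₍₁₎·a)(h₍₂₎·b)` and `h·1 = ε(h)1`. -/
structure HMA (A : Type) [Ring A] [Algebra F A] where
  act : H →ₗ[F] A →ₗ[F] A
  act_one : act 1 = LinearMap.id
  act_mul : ∀ h k : H, act (h * k) = (act h).comp (act k)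
  act_algebraOne : ∀ h : H, act h 1 = (Coalgebra.counit (R := F) h) • (1 : A)
  act_mul_compat :
    (TensorProduct.lift act).comp ((LinearMap.mul' F A).lTensor H)
      = (LinearMap.mul' F A).comp
          (((TensorProduct.map (TensorProduct.lift act) (TensorProduct.lift act)).comp
            (TensorProduct.tensorTensorTensorComm F H H A A).toLinearMap).comp
            ((Coalgebra.comul (R := F) (A := H)).rTensor (A ⊗[F] A)))

variable {A : Type} [Ring A] [Algebra F A]

/-- Evaluation of `H`-polynomials at an assignment `v : V → A` of the variables,
sending `x_v^h` to `h · (v v)`. -/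
def HMA.eval (M : HMA F H A) (v : V → A) : FreeHMA F H V →ₐ[F] A :=
  TensorAlgebra.lift F
    (TensorProduct.lift ((M.act.flip).comp (Finsupp.linearCombination F v)))

/-- The set of `H`-identities of `A` (in variables `V`). -/
def HMA.idSet (M : HMA F H A) (V : Type) : Set (FreeHMA F H V) :=
  {f | ∀ v : V → A, M.eval F H v f = 0}

/-- The `F`-subspace of `H`-identities of `A`. -/
def HMA.idSub (M : HMA F H A) (V : Type) : Submodule F (FreeHMA F H V) :=
  ⨅ v : V → A, LinearMap.ker (M.eval F H v).toLinearMap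

/-! ## `H`-T-ideals -/

/-- The canonical `H`-module algebra structure on the free `H`-module algebra is
characterized by `h · x_v^k = x_v^{hk}` on generators. -/
def IsFreeAction (𝔉 : HMA F H (FreeHMA F H V)) : Prop :=
  ∀ (h k : H) (p : V →₀ F),
    𝔉.act h (TensorAlgebra.ι F (p ⊗ₜ[F] k)) = TensorAlgebra.ι F (p ⊗ₜ[F] (h * k))

/-- An `H`-T-ideal: a two-sided ideal of the free `H`-module algebra stable under all
`H`-endomorphisms, i.e. under all substitutions of the variables by arbitrary
`H`-polynomials (`𝔉` is the free `H`-action). -/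
def IsHTIdeal (𝔉 : HMA F H (FreeHMA F H V)) (Γ : Set (FreeHMA F H V)) : Prop :=
  (0 : FreeHMA F H V) ∈ Γ ∧
  (∀ f g, f ∈ Γ → g ∈ Γ → f + g ∈ Γ) ∧
  (∀ f g, f ∈ Γ → g * f ∈ Γ ∧ f * g ∈ Γ) ∧
  (∀ (v : V → FreeHMA F H V) f, f ∈ Γ → 𝔉.eval F H v f ∈ Γ)

/-- The `H`-T-ideal generated by a set of `H`-polynomials. -/
def hTIdealSpan (𝔉 : HMA F H (FreeHMA F H V)) (s : Set (FreeHMA F H V)) :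
    Set (FreeHMA F H V) :=
  ⋂₀ {Γ | IsHTIdeal F H 𝔉 Γ ∧ s ⊆ Γ}

/-- `Γ` contains the `t`-th Capelli identity: every multilinear `H`-polynomial
alternating in `t` variables belongs to `Γ`. -/
def SatisfiesCapelli (Γ : Set (FreeHMA F H ℕ)) (t : ℕ) : Prop :=
  ∀ (f : FreeHMA F H ℕ) (supp X : Finset ℕ),
    MultilinearOn F H supp supp f → X ⊆ supp → X.card = t → AlternatingOn F H X f → f ∈ Γ

/-! ## The Kemer index -/

/-- There are, for every `μ`, multilinear `H`-polynomials outside `Γ` alternating on `μ`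
disjoint (small) sets of cardinality `a` and on `s` further disjoint (big) sets of
cardinality `a+1`. -/
def HasKemerAlt (Γ : Set (FreeHMA F H ℕ)) (a s : ℕ) : Prop :=
  ∀ μ : ℕ, ∃ (supp : Finset ℕ) (f : FreeHMA F H ℕ)
      (Xs : Fin μ → Finset ℕ) (Ys : Fin s → Finset ℕ),
    f ∉ Γ ∧ MultilinearOn F H supp supp f ∧
    (∀ i, Xs i ⊆ supp) ∧ (∀ j, Ys j ⊆ supp) ∧
    (∀ i, (Xs i).card = a) ∧ (∀ j, (Ys j).card = a + 1) ∧
    Pairwise (fun i i' => Disjoint (Xs i) (Xs i')) ∧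
    Pairwise (fun j j' => Disjoint (Ys j) (Ys j')) ∧
    (∀ i j, Disjoint (Xs i) (Ys j)) ∧
    (∀ i, AlternatingOn F H (Xs i) f) ∧ (∀ j, AlternatingOn F H (Ys j) f)

/-- `α(Γ)`, the first component of the Kemer index. -/
def kemerAlpha (Γ : Set (FreeHMA F H ℕ)) : ℕ :=
  sSup {a | HasKemerAlt F H Γ a 0}

/-- `s(Γ)`, the second component of the Kemer index. -/
def kemerS (Γ : Set (FreeHMA F H ℕ)) : ℕ :=
  sSup {s | HasKemerAlt F H Γ (kemerAlpha F H Γ) s}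

/-- The Kemer index `Ind(Γ) = (α(Γ), s(Γ))`. -/
def kemerIndex (Γ : Set (FreeHMA F H ℕ)) : ℕ × ℕ :=
  (kemerAlpha F H Γ, kemerS F H Γ)

/-- An `H`-Kemer polynomial of `Γ` of rank `μ`. -/
def IsKemerPoly (Γ : Set (FreeHMA F H ℕ)) (μ : ℕ) (f : FreeHMA F H ℕ) : Prop :=
  ∃ (supp : Finset ℕ) (Xs : Fin μ → Finset ℕ)
      (Ys : Fin (kemerS F H Γ) → Finset ℕ),
    f ∉ Γ ∧ MultilinearOn F H supp supp f ∧
    (∀ i, Xs i ⊆ supp) ∧ (∀ j, Ys j ⊆ supp) ∧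
    (∀ i, (Xs i).card = kemerAlpha F H Γ) ∧
    (∀ j, (Ys j).card = kemerAlpha F H Γ + 1) ∧
    Pairwise (fun i i' => Disjoint (Xs i) (Xs i')) ∧
    Pairwise (fun j j' => Disjoint (Ys j) (Ys j')) ∧
    (∀ i j, Disjoint (Xs i) (Ys j)) ∧
    (∀ i, AlternatingOn F H (Xs i) f) ∧ (∀ j, AlternatingOn F H (Ys j) f)

/-! ## Finite dimensional `H`-module algebras, radicals and parameters -/

/-- A bundled finite dimensional `H`-module algebra. -/
structure FDHMA where
  carrier : Type
  [ring : Ring carrier]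
  [alg : Algebra F carrier]
  fd : FiniteDimensional F carrier
  M : HMA F H carrier

attribute [instance] FDHMA.ring FDHMA.alg

/-- The Jacobson radical of an `F`-algebra, as an `F`-subspace. -/
def jacRad (A : Type) [Ring A] [Algebra F A] : Submodule F A :=
  ((⊥ : Ideal A).jacobson).restrictScalars F

/-- The nilpotency index `n_A` of the Jacobson radical. -/
def nilIndex (A : Type) [Ring A] : ℕ :=
  sInf {n : ℕ | ((⊥ : Ideal A).jacobson) ^ n = ⊥}

/-- `d(A)`, the dimension of the semisimple part `A/J(A)`. -/
def ssDim (A : Type) [Ring A] [Algebra F A] : ℕ :=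
  Module.finrank F (A ⧸ jacRad F A)

/-- The parameter `Par(A) = (d(A), n_A - 1)` of a finite dimensional algebra. -/
def par (A : FDHMA F H) : ℕ × ℕ :=
  (ssDim F A.carrier, nilIndex A.carrier - 1)

/-- The `H`-identities (in countably many variables) of a bundled algebra. -/
def FDHMA.ids (A : FDHMA F H) : Set (FreeHMA F H ℕ) :=
  A.M.idSet F H ℕ

/-- An `H`-basic algebra: not `H`-PI-equivalent to a finite direct product of finite
dimensional `H`-module algebras of strictly smaller parameter. -/
def IsHBasic (A : FDHMA F H) : Prop :=
  ¬ ∃ (s : ℕ) (B : Fin s → FDHMA F H),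
      (∀ i, toLex (par F H (B i)) < toLex (par F H A)) ∧
      A.ids F H = ⋂ i, (B i).ids F H

/-- The `H`-ideal of an `H`-module algebra generated by a set. -/
def hIdealSpan (M : HMA F H A) (s : Set A) : Submodule F A :=
  sInf {I : Submodule F A | s ⊆ I ∧ (∀ a : A, ∀ x ∈ I, a * x ∈ I ∧ x * a ∈ I) ∧
    (∀ h : H, ∀ x ∈ I, M.act h x ∈ I)}
/-- The coproduct `S ∗ F^H⟨x₁,...,x_t⟩` of an `F`-algebra `S` with the free `H`-module
algebra on `t` variables, together with its `H`-module algebra structure, presented by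
its universal property. -/
structure HCoprodData (F : Type) [Field F] (H : Type) [Ring H] [Algebra F H]
    [Coalgebra F H] (S : Type) [Ring S] [Algebra F S] (t : ℕ) where
  B' : Type
  [ringB : Ring B']
  [algB : Algebra F B']
  inclS : S →ₐ[F] B'
  inclX : FreeHMA F H (Fin t) →ₐ[F] B'
  universal : ∀ (C : Type) [Ring C] [Algebra F C]
      (f : S →ₐ[F] C) (g : FreeHMA F H (Fin t) →ₐ[F] C),
      ∃! φ : B' →ₐ[F] C, φ.comp inclS = f ∧ φ.comp inclX = g
  M' : HMA F H B'

attribute [instance] HCoprodData.ringB HCoprodData.algB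

/-- A quotient of an `H`-module algebra `B` by the `H`-ideal `K`, presented as a
surjective `H`-equivariant algebra map with kernel `K`. -/
structure HQuotData (F : Type) [Field F] (H : Type) [Ring H] [Algebra F H]
    [Coalgebra F H] (B : Type) [Ring B] [Algebra F B] (M : HMA F H B)
    (K : Submodule F B) where
  Q : Type
  [ringQ : Ring Q]
  [algQ : Algebra F Q]
  N : HMA F H Q
  π : B →ₐ[F] Q
  surj : Function.Surjective π
  equivariant : ∀ (h : H) (x : B), π (M.act h x) = N.act h (π x)
  ker_eq : ∀ x : B, π x = 0 ↔ x ∈ K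

attribute [instance] HQuotData.ringQ HQuotData.algQ

section HopfAux
open Coalgebra HopfAlgebra WithConv

variable {k U B : Type} [Field k] [Ring U] [HopfAlgebra k U] [Ring B] [Algebra k B]

/-- Convolution of linear maps. -/
def cv (f g : U →ₗ[k] B) : U →ₗ[k] B := (toConv f * toConv g).ofConv

/-- The unit for convolution. -/
def cvone : U →ₗ[k] B := (1 : WithConv (U →ₗ[k] B)).ofConv


lemma cv_apply {ι : Type} {x : U} (r : Repr k x ι) (f g : U →ₗ[k] B) :
    cv f g x = ∑ i ∈ r.index, f (r.left i) * g (r.right i) :=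
  r.convMul_apply (toConv f) (toConv g)

lemma cv_assoc (f g h : U →ₗ[k] B) : cv (cv f g) h = cv f (cv g h) := by
  have := mul_assoc (toConv f) (toConv g) (toConv h)
  exact congrArg WithConv.ofConv this

lemma cvone_cv (f : U →ₗ[k] B) : cv cvone f = f :=
  congrArg WithConv.ofConv (one_mul (toConv f))

lemma cv_cvone (f : U →ₗ[k] B) : cv f cvone = f :=
  congrArg WithConv.ofConv (mul_one (toConv f))

lemma cvone_apply (x : U) : (cvone : U →ₗ[k] B) x = algebraMap k B (counit (R := k) x) := rfl

lemma cv_antipode_left (j : U →ₐ[k] B) :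
    cv (j.toLinearMap ∘ₗ antipode k) j.toLinearMap = cvone := by
  ext x
  rw [cv_apply (ℛ k x), cvone_apply]
  simpa using congrArg j (sum_antipode_mul_eq_algebraMap_counit (ℛ k x))

lemma cv_antipode_right (j : U →ₐ[k] B) :
    cv j.toLinearMap (j.toLinearMap ∘ₗ antipode k) = cvone := by
  ext x
  rw [cv_apply (ℛ k x), cvone_apply]
  simpa using congrArg j (sum_mul_antipode_eq_algebraMap_counit (ℛ k x))

variable (k U) in
/-- left inclusion -/
abbrev i1 : U →ₐ[k] U ⊗[k] U := Algebra.TensorProduct.includeLeft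
variable (k U) in
/-- right inclusion -/
abbrev i2 : U →ₐ[k] U ⊗[k] U := Algebra.TensorProduct.includeRight
variable (k U) in
/-- comultiplication as an algebra map -/
abbrev dl : U →ₐ[k] U ⊗[k] U := Bialgebra.comulAlgHom k U
variable (k U) in
/-- the antipode -/
abbrev aS : U →ₗ[k] U := antipode k

lemma dl_eq_cv : (dl k U).toLinearMap = cv (i1 k U).toLinearMap (i2 k U).toLinearMap := by
  ext x
  rw [cv_apply (ℛ k x)]
  simp [(ℛ k x).eq]

/-- `Δ S = (i₂ S) * (i₁ S)`. -/
lemma dl_aS : (dl k U).toLinearMap ∘ₗ aS k U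
    = cv ((i2 k U).toLinearMap ∘ₗ aS k U) ((i1 k U).toLinearMap ∘ₗ aS k U) := by
  have h1 := cv_antipode_left (dl k U)
  have h2 : cv (dl k U).toLinearMap
      (cv ((i2 k U).toLinearMap ∘ₗ aS k U) ((i1 k U).toLinearMap ∘ₗ aS k U)) = cvone := by
    rw [dl_eq_cv, cv_assoc, ← cv_assoc _ _ ((i1 k U).toLinearMap ∘ₗ aS k U),
      cv_antipode_right, cvone_cv, cv_antipode_right]
  calc _ = cv ((dl k U).toLinearMap ∘ₗ aS k U) (cv (dl k U).toLinearMap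
      (cv ((i2 k U).toLinearMap ∘ₗ aS k U) ((i1 k U).toLinearMap ∘ₗ aS k U))) := by
        rw [h2, cv_cvone]
    _ = _ := by rw [← cv_assoc, h1, cvone_cv]

/-- (S h₁ ⊗ 1) Δ h₂ = 1 ⊗ h -/
lemma K1 : cv ((i1 k U).toLinearMap ∘ₗ aS k U) (dl k U).toLinearMap = (i2 k U).toLinearMap := by
  rw [dl_eq_cv, ← cv_assoc, cv_antipode_left, cvone_cv]

/-- Δ h₁ (1 ⊗ S h₂) = h ⊗ 1 -/
lemma K2 : cv (dl k U).toLinearMap ((i2 k U).toLinearMap ∘ₗ aS k U) = (i1 k U).toLinearMap := by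
  rw [dl_eq_cv, cv_assoc, cv_antipode_right, cv_cvone]

/-- Δ (S h₁) (h₂ ⊗ 1) = 1 ⊗ S h -/
lemma K6 : cv ((dl k U).toLinearMap ∘ₗ aS k U) (i1 k U).toLinearMap
    = (i2 k U).toLinearMap ∘ₗ aS k U := by
  rw [dl_aS, cv_assoc, cv_antipode_left, cv_cvone]

lemma comul_aS (x : U) : comul (R := k) (aS k U x)
    = (TensorProduct.comm k U U) (TensorProduct.map (aS k U) (aS k U) (comul x)) := by
  have := LinearMap.congr_fun (dl_aS (k := k) (U := U)) x
  rw [cv_apply (ℛ k x)] at this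
  simp at this
  rw [this, ← (ℛ k x).eq]
  simp

lemma aS_mul (x y : U) : aS k U (x * y) = aS k U y * aS k U x := antipode_mul_antidistrib x y

/-- `(a ⊗ b) ↦ S b ⊗ S a`. -/
def sg : U ⊗[k] U →ₗ[k] U ⊗[k] U :=
  (TensorProduct.comm k U U).toLinearMap ∘ₗ TensorProduct.map (aS k U) (aS k U)

lemma sg_mul (x y : U ⊗[k] U) : sg (x * y) = sg y * sg x := by
  induction x with
  | zero => simp
  | add a b ha hb => simp [add_mul, mul_add, ha, hb]
  | tmul a b =>
    induction y with
    | zero => simp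
    | add c d hc hd => simp [add_mul, mul_add, hc, hd]
    | tmul c d => simp [sg, antipode_mul_antidistrib]

lemma sg_comul (x : U) : sg (comul (R := k) x) = comul (R := k) (aS k U x) := by
  rw [comul_aS]; rfl

variable (k U) in
/-- `S²` -/
def sS : U →ₗ[k] U := aS k U ∘ₗ aS k U

lemma sS_apply (x : U) : sS k U x = antipode k (antipode k x) := rfl
lemma sS_mul (x y : U) : sS k U (x * y) = sS k U x * sS k U y := by
  simp [sS_apply, antipode_mul_antidistrib]
lemma sS_one : sS k U 1 = 1 := by simp [sS_apply]
lemma counit_sS (x : U) : counit (R := k) (sS k U x) = counit (R := k) x := by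
  simp [sS_apply]
lemma comul_sS (x : U) : comul (R := k) (sS k U x)
    = TensorProduct.map (sS k U) (sS k U) (comul x) := by
  rw [sS_apply, comul_aS, comul_aS, ← (ℛ k x).eq]
  simp [sS_apply]

/-- `∑ (1 ⊗ S x₂) Δ(S² x₁) = S² x ⊗ 1`. -/
lemma K5 (x : U) : ∑ i ∈ (ℛ k x).index, (1 ⊗ₜ[k] aS k U ((ℛ k x).right i)) *
    comul (R := k) (sS k U ((ℛ k x).left i)) = sS k U x ⊗ₜ[k] 1 := by
  have h := congrArg sg (LinearMap.congr_fun (K6 (k := k) (U := U)) x)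
  rw [cv_apply (ℛ k x), map_sum] at h
  simp only [sg_mul] at h
  simp only [LinearMap.comp_apply, AlgHom.toLinearMap_apply, Bialgebra.comulAlgHom_apply,
    sg_comul] at h
  simpa [sg, sS_apply] using h

end HopfAux

section HopfInt
open Coalgebra HopfAlgebra

variable {k U : Type} [Field k] [Ring U] [HopfAlgebra k U]

/-- apply a functional to the first leg -/
def leg1 (p : U →ₗ[k] k) : U ⊗[k] U →ₗ[k] U := (TensorProduct.lid k U).toLinearMap ∘ₗ p.rTensor U
/-- apply a functional to the second leg -/
def leg2 (p : U →ₗ[k] k) : U ⊗[k] U →ₗ[k] U := (TensorProduct.rid k U).toLinearMap ∘ₗ p.lTensor U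

@[simp] lemma leg1_tmul (p : U →ₗ[k] k) (a b : U) : leg1 p (a ⊗ₜ b) = p a • b := by
  simp [leg1]
@[simp] lemma leg2_tmul (p : U →ₗ[k] k) (a b : U) : leg2 p (a ⊗ₜ b) = p b • a := by
  simp [leg2]

lemma leg1_counit (x : U) : leg1 (counit (R := k)) (comul x) = x := by
  simp [leg1]
lemma leg2_counit (x : U) : leg2 (counit (R := k)) (comul x) = x := by
  simp [leg2]

/-- functionals on the two legs commute -/
lemma leg_swap (p q : U →ₗ[k] k) (t : U ⊗[k] U) : p (leg2 q t) = q (leg1 p t) := by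
  induction t with
  | zero => simp
  | add a b ha hb => simp [ha, hb]
  | tmul a b => simp [mul_comm]

lemma leg1_mul_right (p : U →ₗ[k] k) (t : U ⊗[k] U) (b : U) :
    leg1 p (t * (1 ⊗ₜ b)) = leg1 p t * b := by
  induction t with
  | zero => simp
  | add a b ha hb => simp [ha, hb, add_mul]
  | tmul a b => simp

lemma leg1_mul_left (p : U →ₗ[k] k) (t : U ⊗[k] U) (b : U) :
    leg1 p ((1 ⊗ₜ b) * t) = b * leg1 p t := by
  induction t with
  | zero => simp
  | add a b ha hb => simp [ha, hb, mul_add]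
  | tmul a b => simp

lemma leg2_mul_right (p : U →ₗ[k] k) (t : U ⊗[k] U) (b : U) :
    leg2 p (t * (b ⊗ₜ 1)) = leg2 p t * b := by
  induction t with
  | zero => simp
  | add a b ha hb => simp [ha, hb, add_mul]
  | tmul a b => simp

lemma leg2_mul_left (p : U →ₗ[k] k) (t : U ⊗[k] U) (b : U) :
    leg2 p ((b ⊗ₜ 1) * t) = b * leg2 p t := by
  induction t with
  | zero => simp
  | add a b ha hb => simp [ha, hb, mul_add]
  | tmul a b => simp

lemma tensor_expand {ι : Type} [Fintype ι] (b : Module.Basis ι k U) (t : U ⊗[k] U) :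
    t = ∑ l, leg2 (b.coord l) t ⊗ₜ[k] b l := by
  induction t with
  | zero => simp
  | add x y hx hy =>
    conv_lhs => rw [hx, hy]
    simp [TensorProduct.add_tmul, Finset.sum_add_distrib]
  | tmul x y =>
    conv_lhs => rw [← b.sum_repr y]
    rw [TensorProduct.tmul_sum]
    refine Finset.sum_congr rfl fun l _ => ?_
    rw [leg2_tmul, TensorProduct.tmul_smul, TensorProduct.smul_tmul']
    rfl


variable (k U) in
/-- the map `x ↦ S²(x) h` -/
def Zm : U →ₗ[k] Module.End k U where
  toFun h := LinearMap.mulRight k h ∘ₗ sS k U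
  map_add' a b := by ext; simp [mul_add]
  map_smul' a b := by ext; simp

lemma Zm_apply (h x : U) : Zm k U h x = sS k U x * h := rfl

variable (k U) in
/-- the functional `h ↦ Tr (x ↦ S²(x) h)` -/
def lamb : U →ₗ[k] k := LinearMap.trace k U ∘ₗ Zm k U

lemma lamb_apply (h : U) : lamb k U h = LinearMap.trace k U (Zm k U h) := rfl

lemma x1S (p : U →ₗ[k] k) (x : U) {ι : Type} [Fintype ι] (b : Module.Basis ι k U) :
    ∑ i, ∑ l, p (aS k U (b i) * b l) •
      leg2 (b.coord i) (comul (leg2 (b.coord l) (comul x))) = p 1 • x := by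
  let T : U ⊗[k] (U ⊗[k] U) →ₗ[k] U := (TensorProduct.rid k U).toLinearMap ∘ₗ
    (p ∘ₗ LinearMap.mul' k U ∘ₗ (aS k U).rTensor U).lTensor U
  have h := congrArg T (Coalgebra.coassoc_apply (R := k) x)
  have hr : T (comul.lTensor U (comul (R := k) x)) = p 1 • x := by
    simp only [T, LinearMap.comp_apply]
    rw [← LinearMap.comp_apply (LinearMap.lTensor U _) (LinearMap.lTensor U _), ← LinearMap.lTensor_comp]
    rw [LinearMap.comp_assoc, LinearMap.comp_assoc, mul_antipode_rTensor_comul]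
    have : p ∘ₗ Algebra.linearMap k U ∘ₗ counit = (p 1) • counit (R := k) (A := U) := by
      ext y; simp [Algebra.algebraMap_eq_smul_one, mul_comm]
    rw [this, LinearMap.lTensor_smul]
    simp
  rw [hr] at h
  rw [← h]
  conv_rhs => rw [tensor_expand b (comul x)]
  rw [map_sum, map_sum, map_sum, Finset.sum_comm]
  refine Finset.sum_congr rfl fun l _ => ?_
  rw [LinearMap.rTensor_tmul]
  conv_rhs => rw [tensor_expand b (comul (leg2 (b.coord l) (comul x)))]
  rw [TensorProduct.sum_tmul, map_sum, map_sum]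
  refine Finset.sum_congr rfl fun i _ => ?_
  simp [T]

variable [FiniteDimensional k U]

/-- the trace functional is a right integral -/
lemma lamb_int (h : U) : leg1 (lamb k U) (comul h) = lamb k U h • (1 : U) := by
  let b := Module.finBasis k U
  suffices hp : ∀ p : U →ₗ[k] k, p (leg1 (lamb k U) (comul h)) = p (lamb k U h • (1 : U)) by
    refine b.ext_elem fun i => ?_
    exact hp (b.coord i)
  intro p
  rw [← leg_swap, lamb_apply]
  let D : Fin (Module.finrank k U) → Module.End k U := fun i => leg2 (b.coord i) ∘ₗ comul
  have h1 : Zm k U (leg2 p (comul h))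
      = ∑ i, ∑ l, p (aS k U (b i) * b l) • (D l ∘ₗ (Zm k U h ∘ₗ D i)) := by
    ext x
    rw [Zm_apply, ← leg2_mul_left, ← K5, Finset.sum_mul]
    let Θ : U ⊗[k] U →ₗ[k] U := leg2 p ∘ₗ LinearMap.mul' k (U ⊗[k] U) ∘ₗ
      TensorProduct.map ((i2 k U).toLinearMap ∘ₗ aS k U) ((dl k U).toLinearMap ∘ₗ Zm k U h) ∘ₗ
      (TensorProduct.comm k U U).toLinearMap
    have e1 : leg2 p (∑ i ∈ (ℛ k x).index, 1 ⊗ₜ[k] aS k U ((ℛ k x).right i) *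
        comul (R := k) (sS k U ((ℛ k x).left i)) * comul h) = Θ (comul x) := by
      rw [← (ℛ k x).eq, map_sum, map_sum]
      refine Finset.sum_congr rfl fun i _ => ?_
      simp [Θ, Zm_apply, mul_assoc]
    rw [e1]
    conv_lhs => rw [tensor_expand b (comul x)]
    rw [map_sum, LinearMap.sum_apply]
    refine Finset.sum_congr rfl fun i _ => ?_
    rw [LinearMap.sum_apply]
    have e2 : Θ (leg2 (b.coord i) (comul x) ⊗ₜ b i)
        = leg2 p ((1 ⊗ₜ aS k U (b i)) * comul (Zm k U h (D i x))) := by simp [Θ, D]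
    rw [e2]
    conv_lhs => rw [tensor_expand b (comul (Zm k U h (D i x)))]
    rw [Finset.mul_sum, map_sum]
    refine Finset.sum_congr rfl fun l _ => ?_
    simp [D]
  rw [h1]
  have h2 : ∀ i l, LinearMap.trace k U (D l ∘ₗ (Zm k U h ∘ₗ D i))
      = LinearMap.trace k U (Zm k U h ∘ₗ (D i ∘ₗ D l)) := fun i l => by
    rw [LinearMap.trace_comp_comm', LinearMap.comp_assoc]
  have h3 : ∑ i, ∑ l, p (aS k U (b i) * b l) • (D i ∘ₗ D l) = p 1 • LinearMap.id := by
    ext x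
    simpa [D] using x1S p x b
  calc _ = LinearMap.trace k U (Zm k U h ∘ₗ
        ∑ i, ∑ l, p (aS k U (b i) * b l) • (D i ∘ₗ D l)) := by
        simp only [← Module.End.mul_eq_comp, Finset.mul_sum, mul_smul_comm, map_sum, map_smul] at h2 ⊢
        simp only [h2]
    _ = _ := by rw [h3, LinearMap.comp_smul, LinearMap.comp_id, map_smul, ← lamb_apply]
                simp [mul_comm]
end HopfInt

section HopfInt2
open Coalgebra HopfAlgebra

variable {k U : Type} [Field k] [Ring U] [HopfAlgebra k U]

variable (k) in
/-- normalized two-sided integrals -/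
structure TwoInt (Λ : U) : Prop where
  left : ∀ h, h * Λ = counit (R := k) h • Λ
  right : ∀ h, Λ * h = counit (R := k) h • Λ
  eps : counit (R := k) Λ = 1

variable {Λ : U}

lemma TwoInt.exch1 (hΛ : TwoInt k Λ) (h : U) :
    (1 ⊗ₜ[k] h) * comul (R := k) Λ = (aS k U h ⊗ₜ[k] 1) * comul (R := k) Λ := by
  have h1 := LinearMap.congr_fun (K1 (k := k) (U := U)) h
  have h2 := LinearMap.congr_fun (cv_cvone ((i1 k U).toLinearMap ∘ₗ aS k U)) h
  rw [cv_apply (ℛ k h)] at h1 h2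
  have e1 : (1 ⊗ₜ[k] h : U ⊗[k] U) = (i2 k U).toLinearMap h := rfl
  have e2 : (aS k U h ⊗ₜ[k] 1 : U ⊗[k] U) = ((i1 k U).toLinearMap ∘ₗ aS k U) h := rfl
  rw [e1, e2, ← h1, ← h2, Finset.sum_mul, Finset.sum_mul]
  refine Finset.sum_congr rfl fun i _ => ?_
  rw [mul_assoc, mul_assoc]
  congr 1
  have : comul (R := k) ((ℛ k h).right i * Λ) = counit (R := k) ((ℛ k h).right i) • comul Λ := by
    rw [hΛ.left, map_smul]
  rw [Bialgebra.comul_mul] at this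
  rw [AlgHom.toLinearMap_apply, Bialgebra.comulAlgHom_apply, this, cvone_apply, Algebra.smul_def]

lemma TwoInt.exch2 (hΛ : TwoInt k Λ) (h : U) :
    comul (R := k) Λ * (h ⊗ₜ[k] 1) = comul (R := k) Λ * (1 ⊗ₜ[k] aS k U h) := by
  have h1 := LinearMap.congr_fun (K2 (k := k) (U := U)) h
  have h2 := LinearMap.congr_fun (cvone_cv ((i2 k U).toLinearMap ∘ₗ aS k U)) h
  rw [cv_apply (ℛ k h)] at h1 h2
  have e1 : (h ⊗ₜ[k] 1 : U ⊗[k] U) = (i1 k U).toLinearMap h := rfl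
  have e2 : (1 ⊗ₜ[k] aS k U h : U ⊗[k] U) = ((i2 k U).toLinearMap ∘ₗ aS k U) h := rfl
  rw [e1, e2, ← h1, ← h2, Finset.mul_sum, Finset.mul_sum]
  refine Finset.sum_congr rfl fun i _ => ?_
  rw [← mul_assoc, ← mul_assoc]
  congr 1
  have : comul (R := k) (Λ * (ℛ k h).left i) = counit (R := k) ((ℛ k h).left i) • comul Λ := by
    rw [hΛ.right, map_smul]
  rw [Bialgebra.comul_mul] at this
  rw [AlgHom.toLinearMap_apply, Bialgebra.comulAlgHom_apply, this, cvone_apply,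
    Algebra.smul_def, Algebra.commutes]

lemma leg1_comp_mulLeft (p : U →ₗ[k] k) (c : U) (t : U ⊗[k] U) :
    leg1 (p ∘ₗ LinearMap.mulLeft k c) t = leg1 p ((c ⊗ₜ 1) * t) := by
  induction t with
  | zero => simp
  | add a b ha hb => simp [ha, hb, mul_add]
  | tmul a b => simp
lemma leg1_comp_mulRight (p : U →ₗ[k] k) (c : U) (t : U ⊗[k] U) :
    leg1 (p ∘ₗ LinearMap.mulRight k c) t = leg1 p (t * (c ⊗ₜ 1)) := by
  induction t with
  | zero => simp
  | add a b ha hb => simp [ha, hb, add_mul]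
  | tmul a b => simp
lemma leg2_comp_mulLeft (p : U →ₗ[k] k) (c : U) (t : U ⊗[k] U) :
    leg2 (p ∘ₗ LinearMap.mulLeft k c) t = leg2 p ((1 ⊗ₜ c) * t) := by
  induction t with
  | zero => simp
  | add a b ha hb => simp [ha, hb, mul_add]
  | tmul a b => simp
lemma leg2_comp_mulRight (p : U →ₗ[k] k) (c : U) (t : U ⊗[k] U) :
    leg2 (p ∘ₗ LinearMap.mulRight k c) t = leg2 p (t * (1 ⊗ₜ c)) := by
  induction t with
  | zero => simp
  | add a b ha hb => simp [ha, hb, add_mul]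
  | tmul a b => simp

variable [FiniteDimensional k U]

lemma TwoInt.lamb (hΛ : TwoInt k Λ) : lamb k U Λ = 1 := by
  rw [lamb_apply]
  have : Zm k U Λ = (counit (R := k) (A := U)).smulRight Λ := by
    ext x
    simp [Zm_apply, hΛ.left, counit_sS]
  rw [this, LinearMap.trace_smulRight, hΛ.eps]

lemma TwoInt.leg1_lamb (hΛ : TwoInt k Λ) : leg1 (_root_.lamb k U) (comul Λ) = 1 := by
  rw [lamb_int, hΛ.lamb, one_smul]

lemma TwoInt.leg1_S (hΛ : TwoInt k Λ) (c : U) :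
    leg1 (_root_.lamb k U) ((aS k U c ⊗ₜ 1) * comul Λ) = c := by
  rw [← hΛ.exch1, leg1_mul_left, hΛ.leg1_lamb, mul_one]

lemma TwoInt.aS_inj (hΛ : TwoInt k Λ) : Function.Injective (aS k U) := by
  intro a b hab
  rw [← hΛ.leg1_S a, ← hΛ.leg1_S b, hab]

lemma TwoInt.sS_inj (hΛ : TwoInt k Λ) : Function.Injective (sS k U) :=
  hΛ.aS_inj.comp hΛ.aS_inj

variable (k) in
/-- `p ↦ p(Λ₁)Λ₂` -/
def phiL (Λ : U) : (U →ₗ[k] k) →ₗ[k] U where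
  toFun p := leg1 p (comul Λ)
  map_add' p q := by simp [leg1, LinearMap.rTensor_add]
  map_smul' c p := by simp [leg1, LinearMap.rTensor_smul]

lemma TwoInt.phi_inj (hΛ : TwoInt k Λ) : Function.Injective (phiL k Λ) := by
  have hs : Function.Surjective (phiL k Λ) := fun c =>
    ⟨_root_.lamb k U ∘ₗ LinearMap.mulLeft k (aS k U c), by
      change leg1 _ _ = _
      rw [leg1_comp_mulLeft, hΛ.leg1_S]⟩
  refine (LinearMap.injective_iff_surjective_of_finrank_eq_finrank ?_).2 hs
  exact Subspace.dual_finrank_eq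

lemma TwoInt.nak' (hΛ : TwoInt k Λ) (b : U) :
    _root_.lamb k U ∘ₗ LinearMap.mulLeft k (sS k U b) = _root_.lamb k U ∘ₗ LinearMap.mulRight k b := by
  apply hΛ.phi_inj
  change leg1 _ _ = leg1 _ _
  rw [leg1_comp_mulLeft, leg1_comp_mulRight, hΛ.exch2, leg1_mul_right, hΛ.leg1_lamb, one_mul]
  exact hΛ.leg1_S _

lemma TwoInt.nak (hΛ : TwoInt k Λ) (b x : U) :
    _root_.lamb k U (sS k U b * x) = _root_.lamb k U (x * b) :=
  LinearMap.congr_fun (hΛ.nak' b) x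

/-- the distinguished element -/
def gEl (k : Type) {U : Type} [Field k] [Ring U] [HopfAlgebra k U] (Λ : U) : U :=
  leg2 (lamb k U) (comul Λ)

lemma TwoInt.S4 (hΛ : TwoInt k Λ) (c : U) :
    sS k U (sS k U c) * gEl k Λ = gEl k Λ * c := by
  have h1 : gEl k Λ * c = leg2 (_root_.lamb k U) (comul Λ * (1 ⊗ₜ aS k U c)) := by
    rw [← hΛ.exch2, leg2_mul_right]; rfl
  rw [h1, ← leg2_comp_mulRight, ← hΛ.nak', leg2_comp_mulLeft, hΛ.exch1, leg2_mul_left]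
  rfl

lemma TwoInt.uniq (hΛ : TwoInt k Λ) (μ : U →ₗ[k] k)
    (hμ : ∀ h, leg1 μ (comul h) = μ h • (1 : U)) : μ = μ Λ • _root_.lamb k U := by
  apply hΛ.phi_inj
  rw [map_smul]
  change leg1 _ _ = _ • leg1 _ _
  rw [hμ, hΛ.leg1_lamb]

lemma leg_coassoc (p q : U →ₗ[k] k) (h : U) :
    leg1 (p ∘ₗ leg2 q ∘ₗ comul) (comul h) = leg1 p ((leg1 q ∘ₗ comul).lTensor U (comul h)) := by
  have h1 := Coalgebra.coassoc_apply (R := k) h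
  let T : U ⊗[k] (U ⊗[k] U) →ₗ[k] U := leg1 p ∘ₗ (leg1 q).lTensor U
  have h2 := congrArg T h1
  simp only [T, LinearMap.comp_apply] at h2
  rw [LinearMap.lTensor_comp, LinearMap.comp_apply, ← h2]
  clear h1 h2
  generalize comul (R := k) h = t
  induction t with
  | zero => simp
  | add a b ha hb => simp only [map_add, ha, hb]
  | tmul a b =>
    simp only [LinearMap.rTensor_tmul, leg1_tmul, LinearMap.comp_apply]
    generalize comul (R := k) a = s
    induction s with
    | zero => simp
    | add a b ha hb => simp only [map_add, ha, hb, add_smul, TensorProduct.add_tmul]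
    | tmul c d => simp [smul_smul, mul_comm]

lemma TwoInt.leg2_lamb (hΛ : TwoInt k Λ) (h : U) :
    leg2 (_root_.lamb k U) (comul h) = _root_.lamb k U h • gEl k Λ := by
  let b := Module.finBasis k U
  refine b.ext_elem fun i => ?_
  have := hΛ.uniq (b.coord i ∘ₗ leg2 (_root_.lamb k U) ∘ₗ comul) ?_
  · have h2 := LinearMap.congr_fun this h
    simp [gEl] at h2 ⊢
    rw [h2, mul_comm]
  · intro h
    rw [leg_coassoc]
    have e : leg1 (_root_.lamb k U) ∘ₗ comul = (_root_.lamb k U).smulRight (1 : U) := by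
      ext x; simp [lamb_int]
    rw [e]
    simp only [LinearMap.comp_apply]
    generalize comul (R := k) h = t
    induction t with
    | zero => simp
    | add a b ha hb => simp only [map_add, ha, hb, add_smul]
    | tmul a b => simp [smul_smul]

lemma TwoInt.g_comul (hΛ : TwoInt k Λ) : comul (R := k) (gEl k Λ) = gEl k Λ ⊗ₜ gEl k Λ := by
  have h1 := Coalgebra.coassoc_apply (R := k) Λ
  have h2 := congrArg ((leg2 (_root_.lamb k U)).lTensor U) h1
  have h3 : (leg2 (_root_.lamb k U)).lTensor U (comul.lTensor U (comul (R := k) Λ))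
      = gEl k Λ ⊗ₜ gEl k Λ := by
    have e : leg2 (_root_.lamb k U) ∘ₗ comul = (_root_.lamb k U).smulRight (gEl k Λ) := by
      ext x; simp [hΛ.leg2_lamb]
    rw [← LinearMap.comp_apply, ← LinearMap.lTensor_comp, e]
    conv_rhs => enter [2]; rw [gEl]
    generalize comul (R := k) Λ = t
    induction t with
    | zero => simp
    | add a b ha hb => simp only [map_add, ha, hb, TensorProduct.add_tmul]
    | tmul a b => simp [TensorProduct.smul_tmul']
  rw [← h3, ← h2, gEl]
  generalize comul (R := k) Λ = t
  induction t with
  | zero => simp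
  | add a b ha hb => simp only [map_add, ha, hb]
  | tmul a b =>
    simp only [leg2_tmul, map_smul, LinearMap.rTensor_tmul]
    generalize comul (R := k) a = s
    induction s with
    | zero => simp
    | add a b ha hb => simp only [map_add, smul_add, ha, hb, TensorProduct.add_tmul]
    | tmul c d => simp

lemma TwoInt.g_counit (hΛ : TwoInt k Λ) : counit (R := k) (gEl k Λ) = 1 := by
  rw [gEl, leg_swap, leg1_counit, hΛ.lamb]

lemma TwoInt.g_gl (hΛ : TwoInt k Λ) : IsGroupLikeElem k (gEl k Λ) :=
  ⟨hΛ.g_counit, hΛ.g_comul⟩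

lemma TwoInt.g_fin (hΛ : TwoInt k Λ) : ∃ n : ℕ, 0 < n ∧ gEl k Λ ^ n = 1 := by
  have hfin : {a : U | IsGroupLikeElem k a}.Finite := by
    have := linearIndepOn_isGroupLikeElem (R := k) (A := U)
    exact this.finite
  have hu : aS k U (gEl k Λ) * gEl k Λ = 1 := hΛ.g_gl.antipode_mul_cancel
  have hni : ¬ Function.Injective (fun n : ℕ => gEl k Λ ^ n) := fun hi =>
    Set.infinite_range_of_injective hi (hfin.subset (by
      rintro _ ⟨n, rfl⟩; exact hΛ.g_gl.pow))
  simp only [Function.Injective, not_forall] at hni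
  obtain ⟨a, b, hab, hne⟩ := hni
  have hu' : IsUnit (gEl k Λ) := ⟨⟨_, _, hΛ.g_gl.mul_antipode_cancel, hu⟩, rfl⟩
  wlog hlt : a < b generalizing a b
  · exact this b a hab.symm (Ne.symm hne) (by omega)
  refine ⟨b - a, by omega, ?_⟩
  apply (hu'.pow a).mul_left_cancel
  rw [← pow_add, mul_one]
  rw [hab]; congr 1; omega

lemma TwoInt.sS_fin (hΛ : TwoInt k Λ) : ∃ n : ℕ, 0 < n ∧ sS k U ^ n = 1 := by
  obtain ⟨n, hn, hg⟩ := hΛ.g_fin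
  refine ⟨2 * n, by omega, ?_⟩
  have hu' : IsUnit (gEl k Λ) := ⟨⟨_, _, hΛ.g_gl.mul_antipode_cancel,
    hΛ.g_gl.antipode_mul_cancel⟩, rfl⟩
  have key : ∀ m : ℕ, ∀ c : U, ((sS k U ^ 2) ^ m) c * gEl k Λ ^ m = gEl k Λ ^ m * c := by
    intro m
    induction m with
    | zero => simp
    | succ m ih =>
      intro c
      rw [pow_succ (sS k U ^ 2), pow_succ (gEl k Λ), Module.End.mul_apply, ← mul_assoc, ih,
        mul_assoc, mul_assoc, ← hΛ.S4 c, pow_two, Module.End.mul_apply]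
  rw [pow_mul]
  ext c
  have := key n c
  simpa [hg] using this
end HopfInt2

section RootProj

/-- spectral projections of an element of finite order -/
def qPr {k R : Type} [Field k] [Ring R] [Algebra k R] (ζ : k) (N : ℕ) (T : R) (j : ℕ) : R :=
  (N : k)⁻¹ • ∑ i ∈ Finset.range N, ((ζ⁻¹ ^ j) • T) ^ i

variable {k R : Type} [Field k] [CharZero k] [Ring R] [Algebra k R] {ζ : k} {N : ℕ} {T : R}

lemma mul_qPr (hN : 0 < N) (hζ : IsPrimitiveRoot ζ N) (hT : T ^ N = 1) (j : ℕ) :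
    T * qPr ζ N T j = ζ ^ j • qPr ζ N T j := by
  have h0 : ζ ≠ 0 := hζ.ne_zero hN.ne'
  have hY : ((ζ⁻¹ ^ j) • T) ^ N = 1 := by
    rw [smul_pow, hT, ← pow_mul, mul_comm, pow_mul, inv_pow, hζ.pow_eq_one]; simp
  have h1 := mul_geom_sum ((ζ⁻¹ ^ j) • T) N
  rw [hY, sub_self, sub_mul, one_mul, sub_eq_zero, smul_mul_assoc] at h1
  have h2 : ζ ^ j * ζ⁻¹ ^ j = 1 := by rw [← mul_pow, mul_inv_cancel₀ h0, one_pow]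
  have h3 := congrArg (fun x => ζ ^ j • x) h1
  simp only [smul_smul, h2, one_smul] at h3
  rw [qPr, mul_smul_comm, h3, smul_comm]

lemma pow_mul_qPr (hN : 0 < N) (hζ : IsPrimitiveRoot ζ N) (hT : T ^ N = 1) (j e : ℕ) :
    T ^ e * qPr ζ N T j = (ζ ^ j) ^ e • qPr ζ N T j := by
  induction e with
  | zero => simp
  | succ e ih => rw [pow_succ, mul_assoc, mul_qPr hN hζ hT, mul_smul_comm, ih, smul_smul,
      pow_succ, mul_comm]

lemma qPr_idem (hN : 0 < N) (hζ : IsPrimitiveRoot ζ N) (hT : T ^ N = 1) (j : ℕ) :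
    qPr ζ N T j * qPr ζ N T j = qPr ζ N T j := by
  have h0 : ζ ≠ 0 := hζ.ne_zero hN.ne'
  conv_lhs => enter [1]; rw [qPr]
  rw [smul_mul_assoc, Finset.sum_mul]
  have : ∀ i ∈ Finset.range N, ((ζ⁻¹ ^ j) • T) ^ i * qPr ζ N T j = qPr ζ N T j := by
    intro i _
    rw [smul_pow, smul_mul_assoc, pow_mul_qPr hN hζ hT, smul_smul, ← mul_pow, ← mul_pow,
      inv_mul_cancel₀ h0]
    simp
  rw [Finset.sum_congr rfl this, Finset.sum_const, Finset.card_range, ← Nat.cast_smul_eq_nsmul k,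
    smul_smul, inv_mul_cancel₀ (by exact_mod_cast hN.ne'), one_smul]

lemma sum_qPr (hN : 0 < N) (hζ : IsPrimitiveRoot ζ N) :
    ∑ j ∈ Finset.range N, qPr ζ N T j = 1 := by
  have h0 : ζ ≠ 0 := hζ.ne_zero hN.ne'
  simp only [qPr]
  rw [← Finset.smul_sum, Finset.sum_comm]
  have : ∀ i ∈ Finset.range N, i ≠ 0 →
      ∑ j ∈ Finset.range N, ((ζ⁻¹ ^ j) • T) ^ i = (0 : R) := by
    intro i hi hi0
    simp only [smul_pow, ← Finset.sum_smul]
    have h1 : ∀ j, (ζ⁻¹ ^ j) ^ i = (ζ⁻¹ ^ i) ^ j := fun j => by rw [← pow_mul, ← pow_mul, mul_comm]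
    simp only [h1]
    have h2 := geom_sum_mul (ζ⁻¹ ^ i) N
    rw [← pow_mul, mul_comm i N, pow_mul, hζ.inv.pow_eq_one] at h2
    simp only [one_pow, sub_self, mul_eq_zero] at h2
    rcases h2 with h2 | h2
    · rw [h2, zero_smul]
    · exfalso
      rw [sub_eq_zero] at h2
      have := (hζ.inv.pow_eq_one_iff_dvd i).1 h2
      exact hi0 (Nat.eq_zero_of_dvd_of_lt this (Finset.mem_range.1 hi))
  rw [Finset.sum_eq_single_of_mem 0 (Finset.mem_range.2 hN) (fun i hi hi0 => this i hi hi0)]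
  simp only [pow_zero, Finset.sum_const, Finset.card_range, ← Nat.cast_smul_eq_nsmul k, smul_smul]
  rw [inv_mul_cancel₀ (by exact_mod_cast hN.ne'), one_smul]

lemma qPr_commute {E : R} (h : Commute T E) (j : ℕ) : Commute (qPr ζ N T j) E := by
  unfold qPr
  refine Commute.smul_left (Commute.sum_left _ _ _ fun i _ => ?_) _
  exact (h.smul_left _).pow_left _

variable {V : Type} [AddCommGroup V] [Module k V] [FiniteDimensional k V]

lemma trace_idem (P : Module.End k V) (hP : P * P = P) :
    LinearMap.trace k V P = (Module.finrank k (LinearMap.range P) : k) := by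
  apply LinearMap.IsProj.trace
  exact ⟨fun x => ⟨x, rfl⟩, by rintro _ ⟨x, rfl⟩; exact LinearMap.congr_fun hP x⟩

/-- multiplicities -/
def mPr (ζ : k) (N : ℕ) (T E : Module.End k V) (j : ℕ) : ℕ :=
  Module.finrank k (LinearMap.range (qPr ζ N T j * E))

lemma trace_pow_mul {T E : Module.End k V} (hN : 0 < N) (hζ : IsPrimitiveRoot ζ N)
    (hT : T ^ N = 1) (hE : E * E = E) (h : Commute T E) (e : ℕ) :
    LinearMap.trace k V (T ^ e * E)
      = ∑ j ∈ Finset.range N, (mPr ζ N T E j : k) * (ζ ^ j) ^ e := by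
  have h1 : T ^ e * E = ∑ j ∈ Finset.range N, (ζ ^ j) ^ e • (qPr ζ N T j * E) := by
    conv_lhs => rw [← mul_one (T ^ e), ← sum_qPr (T := T) hN hζ, Finset.mul_sum, Finset.sum_mul]
    refine Finset.sum_congr rfl fun j _ => ?_
    rw [pow_mul_qPr hN hζ hT, smul_mul_assoc]
  rw [h1, map_sum]
  refine Finset.sum_congr rfl fun j _ => ?_
  rw [map_smul, trace_idem, smul_eq_mul, mul_comm]; rfl
  rw [mul_assoc, ← mul_assoc E, ← (qPr_commute h j).eq, mul_assoc, hE, ← mul_assoc,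
    qPr_idem hN hζ hT]
end RootProj

section Wed

variable {k : Type} [Field k]

lemma conj_root {N : ℕ} (hN : 0 < N) {ω : ℂ} (h : ω ^ N = 1) :
    ω ^ (N - 1) = (starRingEnd ℂ) ω := by
  have hn : ‖ω‖ = 1 := Complex.norm_eq_one_of_pow_eq_one h hN.ne'
  have h0 : ω ≠ 0 := by rintro rfl; simp at hn
  have h1 : ω * ω ^ (N - 1) = 1 := by rw [← pow_succ', Nat.sub_add_cancel hN, h]
  have h2 : ω * (starRingEnd ℂ) ω = 1 := by rw [Complex.mul_conj']; simp [hn]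
  exact mul_left_cancel₀ h0 (h1.trans h2.symm)

lemma exists_zeta (N : ℕ) [NeZero N] : ∃ z : CyclotomicField N ℚ, IsPrimitiveRoot z N := by
  have hNZQ : NeZero (N : ℚ) := ⟨by exact_mod_cast NeZero.ne N⟩
  exact ⟨_, @IsCyclotomicExtension.zeta_spec N _ ℚ (CyclotomicField N ℚ) _ _
    (CyclotomicField.algebra N ℚ) (CyclotomicField.isCyclotomicExtension N ℚ)⟩

lemma pos_roots {K : Type} [Field K] [NumberField K] {N : ℕ} (hN : 0 < N) {z : K}
    (hz : z ^ N = 1) (f : K →+* k) {n : ℕ} (m : Fin n → ℕ → ℕ)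
    (h : ∑ i, (∑ j ∈ Finset.range N, (m i j : k) * (f z ^ j) ^ 1) *
      (∑ j ∈ Finset.range N, (m i j : k) * (f z ^ j) ^ (N - 1)) = 0) (i : Fin n) :
    ∑ j ∈ Finset.range N, (m i j : k) * (f z ^ j) ^ (N - 1) = 0 := by
  let a : Fin n → K := fun i => ∑ j ∈ Finset.range N, (m i j : K) * (z ^ j) ^ 1
  let b : Fin n → K := fun i => ∑ j ∈ Finset.range N, (m i j : K) * (z ^ j) ^ (N - 1)
  have ha : ∀ i, f (a i) = ∑ j ∈ Finset.range N, (m i j : k) * (f z ^ j) ^ 1 := by simp [a]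
  have hb : ∀ i, f (b i) = ∑ j ∈ Finset.range N, (m i j : k) * (f z ^ j) ^ (N - 1) := by simp [b]
  simp only [← ha, ← hb, ← map_mul, ← map_sum] at h
  rw [← hb]
  have h0 : ∑ i, a i * b i = 0 := f.injective (by rw [h, map_zero])
  obtain ⟨φ⟩ : Nonempty (K →+* ℂ) := inferInstance
  have hc : ∀ i, φ (b i) = (starRingEnd ℂ) (φ (a i)) := by
    intro i
    simp only [a, b, map_sum, map_mul, map_pow, map_natCast, pow_one]
    refine Finset.sum_congr rfl fun j _ => ?_
    rw [conj_root hN, map_pow]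
    rw [← pow_mul, mul_comm, pow_mul, ← map_pow, hz]; simp
  have h1 : ∑ i, φ (a i) * (starRingEnd ℂ) (φ (a i)) = 0 := by
    have := congrArg φ h0
    simpa [hc] using this
  have h2 : ∑ i, ‖φ (a i)‖ ^ 2 = 0 := by
    simp only [Complex.mul_conj'] at h1
    exact_mod_cast h1
  have h3 := (Finset.sum_eq_zero_iff_of_nonneg (fun i _ => by positivity)).1 h2 i (Finset.mem_univ _)
  have h4 : φ (a i) = 0 := by simpa using h3
  have h5 : φ (b i) = 0 := by rw [hc, h4]; simp
  have : b i = 0 := φ.injective (by rw [h5, map_zero])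
  rw [this, map_zero]

variable {n : ℕ} {d : Fin n → ℕ}

/-- product of matrix algebras -/
abbrev PM (k : Type) {n : ℕ} (d : Fin n → ℕ) : Type := Π i, Matrix (Fin (d i)) (Fin (d i)) k

/-- sum of traces -/
def tau : PM k d →ₗ[k] k where
  toFun x := ∑ i, (x i).trace
  map_add' x y := by simp [Finset.sum_add_distrib]
  map_smul' c x := by simp [Finset.mul_sum]

lemma tau_apply (x : PM k d) : tau x = ∑ i, (x i).trace := rfl

lemma tau_comm (x y : PM k d) : tau (x * y) = tau (y * x) := by
  simp only [tau_apply, Pi.mul_apply]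
  exact Finset.sum_congr rfl fun i _ => Matrix.trace_mul_comm _ _

lemma tau_single (y : PM k d) (i : Fin n) (a b : Fin (d i)) :
    tau (y * Pi.single i (Matrix.single a b 1)) = y i b a := by
  rw [tau_apply, Finset.sum_eq_single i]
  · simp [Matrix.trace_mul_single]
  · intro j _ hj
    simp [Pi.single_eq_of_ne hj]
  · simp

lemma tau_nondeg (y : PM k d) (h : ∀ x, tau (y * x) = 0) : y = 0 := by
  funext i
  ext a b
  rw [← tau_single y i b a, h]; rfl

lemma tau_repr (lam : PM k d →ₗ[k] k) : ∃ w : PM k d, ∀ x, lam x = tau (w * x) := by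
  refine ⟨fun i => Matrix.of fun b a => lam (Pi.single i (Matrix.single a b 1)), ?_⟩
  let w : PM k d := fun i => Matrix.of fun b a => lam (Pi.single i (Matrix.single a b 1))
  have : lam = tau ∘ₗ LinearMap.mulLeft k w := by
    refine (Pi.basis (fun i => Matrix.stdBasis k (Fin (d i)) (Fin (d i)))).ext ?_
    rintro ⟨i, a, b⟩
    rw [Pi.basis_apply, Matrix.stdBasis_eq_single, LinearMap.comp_apply, LinearMap.mulLeft_apply,
      tau_single]
    rfl
  intro x
  exact LinearMap.congr_fun this x

lemma trace_LR (v u : PM k d) :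
    LinearMap.trace k (PM k d) (LinearMap.mulLeft k v ∘ₗ LinearMap.mulRight k u)
      = ∑ i, (v i).trace * (u i).trace := by
  rw [LinearMap.trace_eq_matrix_trace k
    (Pi.basis (fun i => Matrix.stdBasis k (Fin (d i)) (Fin (d i)))), Matrix.trace,
    Fintype.sum_sigma]
  refine Finset.sum_congr rfl fun i _ => ?_
  rw [Fintype.sum_prod_type, Matrix.trace, Matrix.trace, Finset.sum_mul_sum]
  refine Finset.sum_congr rfl fun a _ => Finset.sum_congr rfl fun b _ => ?_
  rw [Matrix.diag_apply, LinearMap.toMatrix_apply, Pi.basis_apply, Matrix.stdBasis_eq_single]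
  simp only [Pi.basis_repr, LinearMap.comp_apply, LinearMap.mulLeft_apply, LinearMap.mulRight_apply,
    Pi.mul_apply, Pi.single_eq_same]
  change (v i * (Matrix.single a b (1 : k) * u i) : Matrix (Fin (d i)) (Fin (d i)) k) a b = _
  rw [Matrix.mul_apply, Finset.sum_eq_single a]
  · simp
  · intro c _ hc
    simp [Matrix.single_mul_apply_of_ne _ _ _ _ _ hc]
  · simp

lemma wed_nonvanish [CharZero k] [IsAlgClosed k] (hd : ∀ i, NeZero (d i))
    (σ : Module.End k (PM k d)) (lam : PM k d →ₗ[k] k) {N : ℕ} (hN : 0 < N)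
    (h1 : σ ^ N = 1) (h2 : ∀ b x, lam (σ b * x) = lam (x * b))
    (h3 : ∀ h, lam h = LinearMap.trace k _ (LinearMap.mulRight k h ∘ₗ σ))
    (h4 : ∀ b, (∀ x, lam (x * b) = 0) → b = 0) (h5 : lam ≠ 0) :
    LinearMap.trace k _ σ ≠ 0 := by
  obtain ⟨w, hw⟩ := tau_repr lam
  have hwσ : ∀ b, w * σ b = b * w := by
    intro b
    rw [← sub_eq_zero]
    apply tau_nondeg
    intro x
    rw [sub_mul, map_sub, mul_assoc, ← hw, h2, hw, ← mul_assoc w x b, tau_comm (w * x) b,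
      mul_assoc, sub_self]
  have hinj : ∀ y, y * w = 0 → y = 0 := by
    intro y hy
    apply h4
    intro x
    rw [hw, ← mul_assoc, tau_comm, ← mul_assoc, hy, zero_mul, map_zero]
  have hinj' : Function.Injective (LinearMap.mulRight k w) := by
    rw [injective_iff_map_eq_zero]
    exact hinj
  obtain ⟨v, hv⟩ := LinearMap.injective_iff_surjective.1 hinj' 1
  replace hv : v * w = 1 := hv
  have hv' : w * v = 1 := by
    have := hinj (w * v - 1) (by rw [sub_mul, mul_assoc, hv]; simp)
    rwa [sub_eq_zero] at this
  have hσ : ∀ b, σ b = v * b * w := by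
    intro b
    rw [mul_assoc, ← hwσ, ← mul_assoc, hv, one_mul]
  have hlam : ∀ h, lam h = ∑ i, (v i).trace * (w i * h i).trace := by
    intro h
    rw [h3]
    have : LinearMap.mulRight k h ∘ₗ σ = LinearMap.mulLeft k v ∘ₗ LinearMap.mulRight k (w * h) := by
      apply LinearMap.ext
      intro x
      simp [hσ, mul_assoc]
    rw [this, trace_LR]; rfl
  have hpow : ∀ m b, w ^ m * (σ ^ m) b = b * w ^ m := by
    intro m
    induction m with
    | zero => simp
    | succ m ih =>
      intro b
      rw [pow_succ, pow_succ', Module.End.mul_apply, ← mul_assoc b, mul_assoc, hwσ,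
        ← mul_assoc, ih]
  have hcent : ∀ b, w ^ N * b = b * w ^ N := by
    intro b
    have := hpow N b
    rwa [h1, Module.End.one_apply] at this
  have hsc : ∀ i, ∃ c : k, (w i) ^ N = Matrix.scalar (Fin (d i)) c := by
    intro i
    have := Matrix.mem_range_scalar_of_commute_single (M := (w i) ^ N) ?_
    · obtain ⟨c, hc⟩ := this
      exact ⟨c, hc.symm⟩
    · intro a b _
      have := congrFun (hcent (Pi.single i (Matrix.single a b 1))) i
      simp only [Pi.mul_apply, Pi.pow_apply, Pi.single_eq_same] at this
      exact this.symm
  choose c hc using hsc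
  have hγ : ∀ i, ∃ γ : k, γ ^ N = c i := fun i => IsAlgClosed.exists_pow_nat_eq _ hN
  choose γ hγ using hγ
  have hvi : ∀ i, v i * w i = 1 := fun i => congrFun hv i
  have hwi : ∀ i, w i * v i = 1 := fun i => congrFun hv' i
  have hγ0 : ∀ i, γ i ≠ 0 := by
    intro i h0
    have : (w i) ^ N = 0 := by rw [hc, ← hγ, h0, zero_pow hN.ne', map_zero]
    have hu : IsUnit (w i) := ⟨⟨_, _, hwi i, hvi i⟩, rfl⟩
    have := hd i
    exact (hu.pow N).ne_zero ‹_›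
  let u : PM k d := fun i => (γ i)⁻¹ • w i
  have hu : ∀ i, (u i) ^ N = 1 := by
    intro i
    simp only [u, smul_pow, hc, ← hγ, inv_pow]
    rw [Matrix.scalar_apply, ← Matrix.smul_one_eq_diagonal, smul_smul, inv_mul_cancel₀ (pow_ne_zero _ (hγ0 i)), one_smul]
  have huv : ∀ i, v i = (γ i)⁻¹ • (u i) ^ (N - 1) := by
    intro i
    have e : ((γ i)⁻¹ • (u i) ^ (N - 1)) * w i = 1 := by
      have : w i = γ i • u i := by simp [u, smul_smul, mul_inv_cancel₀ (hγ0 i)]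
      rw [this, smul_mul_smul_comm, inv_mul_cancel₀ (hγ0 i), one_smul, ← pow_succ,
        Nat.sub_add_cancel hN, hu]
    calc v i = (((γ i)⁻¹ • (u i) ^ (N - 1)) * w i) * v i := by rw [e, one_mul]
      _ = _ := by rw [mul_assoc, hwi, mul_one]
  have hNZ : NeZero N := ⟨hN.ne'⟩
  have hNZQ : NeZero (N : ℚ) := ⟨by exact_mod_cast hN.ne'⟩
  obtain ⟨z, hz⟩ : ∃ z : CyclotomicField N ℚ, IsPrimitiveRoot z N := exists_zeta N
  let f : CyclotomicField N ℚ →+* k := (IsAlgClosed.lift (R := ℚ) (S := CyclotomicField N ℚ) (M := k)).toRingHom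
  have hfz : IsPrimitiveRoot (f z) N := hz.map_of_injective f.injective
  let m : Fin n → ℕ → ℕ := fun i => mPr (f z) N (Matrix.toLin' (u i)) 1
  have htr : ∀ i e, ((u i) ^ e).trace = ∑ j ∈ Finset.range N, (m i j : k) * (f z ^ j) ^ e := by
    intro i e
    rw [← trace_pow_mul hN hfz _ (one_mul 1) (Commute.one_right _), mul_one, ← Matrix.toLin'_pow,
      Matrix.trace_toLin'_eq]
    rw [← Matrix.toLin'_pow, hu, Matrix.toLin'_one]; rfl
  have htrσ : LinearMap.trace k _ σ = ∑ i, ((u i) ^ 1).trace * ((u i) ^ (N - 1)).trace := by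
    have e := hlam 1
    rw [h3] at e
    have e2 : LinearMap.mulRight k (1 : PM k d) ∘ₗ σ = σ := by
      apply LinearMap.ext; intro x; simp
    rw [e2] at e
    rw [e]
    refine Finset.sum_congr rfl fun i _ => ?_
    have : w i = γ i • u i := by simp [u, smul_smul, mul_inv_cancel₀ (hγ0 i)]
    rw [Pi.one_apply, mul_one, huv, this, Matrix.trace_smul, Matrix.trace_smul, pow_one]
    simp only [smul_eq_mul]
    field_simp [hγ0 i]
  intro h0
  apply h5
  apply LinearMap.ext
  intro x
  rw [htrσ] at h0
  simp only [htr] at h0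
  have h6 := pos_roots hN hz.pow_eq_one f m h0
  rw [hlam]
  refine Finset.sum_eq_zero fun i _ => ?_
  rw [huv, Matrix.trace_smul, htr, h6, smul_zero, zero_mul]

lemma wed_nonvanish' [CharZero k] [IsAlgClosed k] {U : Type} [Ring U] [Algebra k U]
    [FiniteDimensional k U] [IsSemisimpleRing U]
    (σ : Module.End k U) (lam : U →ₗ[k] k) {N : ℕ} (hN : 0 < N)
    (h1 : σ ^ N = 1) (h2 : ∀ b x, lam (σ b * x) = lam (x * b))
    (h3 : ∀ h, lam h = LinearMap.trace k _ (LinearMap.mulRight k h ∘ₗ σ))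
    (h4 : ∀ b, (∀ x, lam (x * b) = 0) → b = 0) (h5 : lam ≠ 0) :
    LinearMap.trace k _ σ ≠ 0 := by
  obtain ⟨n, d, hd, ⟨e⟩⟩ := IsSemisimpleRing.exists_algEquiv_pi_matrix_of_isAlgClosed k U
  have hpow : ∀ m, e.toLinearEquiv.conj σ ^ m = e.toLinearEquiv.conj (σ ^ m) := by
    intro m
    induction m with
    | zero => simp [Module.End.one_eq_id]
    | succ m ih => rw [pow_succ, ih, pow_succ, Module.End.mul_eq_comp, Module.End.mul_eq_comp,
        LinearEquiv.conj_comp]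
  have := wed_nonvanish hd (e.toLinearEquiv.conj σ) (lam ∘ₗ e.symm.toLinearMap) hN
    (by rw [hpow, h1]; simp [Module.End.one_eq_id])
    (fun b x => by simp [LinearEquiv.conj_apply, h2])
    (fun h => by
      rw [LinearMap.comp_apply, h3, ← LinearMap.trace_conj' _ e.toLinearEquiv]
      congr 1
      apply LinearMap.ext
      intro x
      simp [LinearEquiv.conj_apply])
    (fun b hb => by
      have := h4 (e.symm b) (fun x => by simpa using hb (e x))
      simpa using this)
    (fun h => h5 (by
      apply LinearMap.ext
      intro x
      simpa using LinearMap.congr_fun h (e x)))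
  rwa [LinearMap.trace_conj'] at this
end Wed

section FinalRoots

lemma final_roots {K : Type} [Field K] [NumberField K] {N : ℕ} (hN : 0 < N) {z : K}
    (hz : IsPrimitiveRoot z N) (m m' : ℕ → ℕ) (D : ℕ) (hD : ∑ j ∈ Finset.range N, m j = D)
    (hm0 : 0 < m 0)
    (h : ∑ j ∈ Finset.range N, (m j : K) * z ^ j = D * ∑ j ∈ Finset.range N, (m' j : K) * z ^ j)
    (hne : ∑ j ∈ Finset.range N, (m j : K) * z ^ j ≠ 0) :
    ∀ j, j < N → j ≠ 0 → m j = 0 := by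
  set a : K := ∑ j ∈ Finset.range N, (m' j : K) * z ^ j with ha
  have hDpos : 0 < D := by
    rw [← hD]
    exact Finset.sum_pos' (fun _ _ => Nat.zero_le _) ⟨0, Finset.mem_range.2 hN, hm0⟩
  have ha0 : a ≠ 0 := by
    rintro h0
    rw [h0, mul_zero] at h
    exact hne h
  have hzi : IsIntegral ℤ z := hz.isIntegral hN
  have hai : IsIntegral ℤ a := by
    rw [ha]
    refine IsIntegral.sum _ fun j _ => ?_
    refine IsIntegral.mul ?_ (hzi.pow j)
    have := isIntegral_algebraMap (R := ℤ) (A := K) (x := (m' j : ℤ))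
    simpa using this
  have hroot : ∀ φ : K →+* ℂ, ∀ j, ‖φ z ^ j‖ = 1 := by
    intro φ j
    rw [norm_pow, Complex.norm_eq_one_of_pow_eq_one (n := N) _ hN.ne', one_pow]
    rw [← map_pow, hz.pow_eq_one, map_one]
  have hφ : ∀ φ : K →+* ℂ, ∑ j ∈ Finset.range N, (m j : ℂ) * φ z ^ j = D * φ a := by
    intro φ
    have := congrArg φ h
    simpa only [map_sum, map_mul, map_natCast, map_pow] using this
  have hle : ∀ φ : K →+* ℂ, ‖φ a‖ ≤ 1 := by
    intro φ
    have h1 : ‖(D : ℂ) * φ a‖ ≤ D := by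
      rw [← hφ φ]
      refine (norm_sum_le _ _).trans ?_
      rw [← hD]
      push_cast
      refine Finset.sum_le_sum fun j _ => ?_
      rw [norm_mul, hroot, mul_one]
      simp
    rw [norm_mul] at h1
    have hD' : (0 : ℝ) < D := by exact_mod_cast hDpos
    have h2 : ‖(D : ℂ)‖ = D := by simp
    rw [h2] at h1
    nlinarith
  obtain ⟨n, hn, han⟩ := NumberField.Embeddings.pow_eq_one_of_norm_le_one K ℂ ha0 hai hle
  obtain ⟨φ⟩ : Nonempty (K →+* ℂ) := inferInstance
  have hα : ‖φ a‖ = 1 := Complex.norm_eq_one_of_pow_eq_one (n := n) (by rw [← map_pow, han, map_one]) hn.ne'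
  set c := (starRingEnd ℂ) (φ a) with hc
  have hcn : ‖c‖ = 1 := by rw [hc, Complex.norm_conj, hα]
  have hca : φ a * c = 1 := by rw [hc, Complex.mul_conj', hα]; simp
  have hre : ∀ j, (φ z ^ j * c).re ≤ 1 := by
    intro j
    refine (Complex.re_le_norm _).trans ?_
    rw [norm_mul, hroot, hcn, one_mul]
  have hsum : ∑ j ∈ Finset.range N, (m j : ℝ) * (1 - (φ z ^ j * c).re) = 0 := by
    have h1 := congrArg (fun x => (x * c).re) (hφ φ)
    simp only [mul_assoc, hca, mul_one, Finset.sum_mul] at h1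
    rw [Complex.re_sum] at h1
    simp only [mul_sub, Finset.sum_sub_distrib, mul_one]
    rw [← Nat.cast_sum, hD]
    have h2 : ∀ j, ((m j : ℂ) * (φ z ^ j * c)).re = (m j : ℝ) * (φ z ^ j * c).re := by
      intro j
      have := Complex.re_ofReal_mul (m j : ℝ) (φ z ^ j * c)
      simpa using this
    simp only [h2] at h1
    rw [h1]; simp
  have hz0 := (Finset.sum_eq_zero_iff_of_nonneg (fun j _ => mul_nonneg (Nat.cast_nonneg _)
    (sub_nonneg.2 (hre j)))).1 hsum
  have hkey : ∀ j, j < N → m j ≠ 0 → φ z ^ j = φ a := by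
    intro j hj hmj
    have h1 := hz0 j (Finset.mem_range.2 hj)
    have h2 : (φ z ^ j * c).re = 1 := by
      rcases mul_eq_zero.1 h1 with h | h
      · exact absurd (by exact_mod_cast h) hmj
      · linarith
    have h3 : ‖φ z ^ j * c‖ = 1 := by rw [norm_mul, hroot, hcn, one_mul]
    have h4 : φ z ^ j * c = 1 := by
      have h5 := Complex.sq_norm (φ z ^ j * c)
      rw [h3, Complex.normSq_apply, h2] at h5
      have h6 : (φ z ^ j * c).im = 0 := by nlinarith
      exact Complex.ext (by simpa using h2) (by simpa using h6)
    have hc0 : c ≠ 0 := by intro h; rw [h] at hcn; simp at hcn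
    exact mul_right_cancel₀ hc0 (h4.trans hca.symm)
  intro j hj hj0
  by_contra hmj
  have h1 := hkey j hj hmj
  rw [← hkey 0 hN hm0.ne', pow_zero, ← map_pow, ← map_one φ] at h1
  have h2 := (hz.pow_eq_one_iff_dvd j).1 (φ.injective h1)
  exact hj0 (Nat.eq_zero_of_dvd_of_lt h2 hj)
end FinalRoots

section Radford
open Coalgebra HopfAlgebra

variable {k U : Type} [Field k] [Ring U] [HopfAlgebra k U] [FiniteDimensional k U] {Λ : U}

lemma TwoInt.aS_surj (hΛ : TwoInt k Λ) : Function.Surjective (aS k U) :=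
  LinearMap.injective_iff_surjective.1 hΛ.aS_inj

lemma TwoInt.aS_eq (hΛ : TwoInt k Λ) : aS k U Λ = Λ := by
  have h1 : ∀ h, h * aS k U Λ = counit (R := k) h • aS k U Λ := by
    intro h
    obtain ⟨y, rfl⟩ := hΛ.aS_surj h
    rw [← aS_mul, hΛ.right, map_smul]; simp
  have h2 := h1 Λ
  rw [hΛ.right, hΛ.eps, one_smul] at h2
  have h3 : counit (R := k) (aS k U Λ) = 1 := by simp [hΛ.eps]
  rw [← h2, h3, one_smul]

lemma TwoInt.cas (hΛ : TwoInt k Λ) {W : Type} [AddCommGroup W] [Module k W]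
    (β : U →ₗ[k] U →ₗ[k] W) (h : U) :
    ∑ i ∈ (ℛ k Λ).index, β (h * (ℛ k Λ).left i) (aS k U ((ℛ k Λ).right i))
      = ∑ i ∈ (ℛ k Λ).index, β ((ℛ k Λ).left i) (aS k U ((ℛ k Λ).right i) * h) := by
  obtain ⟨y, rfl⟩ := hΛ.aS_surj h
  have h1 := congrArg (TensorProduct.lift (β.compl₂ (aS k U))) (hΛ.exch1 y)
  rw [← (ℛ k Λ).eq, Finset.mul_sum, Finset.mul_sum, map_sum, map_sum] at h1
  simp only [Algebra.TensorProduct.tmul_mul_tmul, one_mul, TensorProduct.lift.tmul,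
    LinearMap.compl₂_apply, aS_mul] at h1
  exact h1.symm

lemma TwoInt.maschke (hΛ : TwoInt k Λ) : IsSemisimpleRing U := by
  have : ComplementedLattice (Submodule U U) := by
    refine ⟨fun I => ?_⟩
    obtain ⟨P, hP⟩ := LinearMap.exists_leftInverse_of_injective
      (I.restrictScalars k).subtype (by simp)
    let p : U →ₗ[k] U := (I.restrictScalars k).subtype ∘ₗ P
    have hpI : ∀ x, p x ∈ I := fun x => (P x).2
    have hpid : ∀ x ∈ I, p x = x := by
      intro x hx
      have := LinearMap.congr_fun hP ⟨x, hx⟩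
      exact congrArg Subtype.val this
    let q : U → U := fun x => ∑ i ∈ (ℛ k Λ).index,
      (ℛ k Λ).left i * p (aS k U ((ℛ k Λ).right i) * x)
    have hqlin : ∀ h x, q (h * x) = h * q x := by
      intro h x
      let β : U →ₗ[k] U →ₗ[k] U := (LinearMap.mul k U).compl₂ (p ∘ₗ LinearMap.mulRight k x)
      have := hΛ.cas β h
      simp only [β, LinearMap.compl₂_apply, LinearMap.mul_apply', LinearMap.comp_apply,
        LinearMap.mulRight_apply] at this
      simp only [q, Finset.mul_sum, ← mul_assoc] at this ⊢
      rw [← this]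
    have hqI : ∀ x, q x ∈ I := fun x => Submodule.sum_mem _ fun i _ =>
      I.smul_mem _ (hpI _)
    have hqid : ∀ x ∈ I, q x = x := by
      intro x hx
      simp only [q]
      have : ∀ i ∈ (ℛ k Λ).index, (ℛ k Λ).left i * p (aS k U ((ℛ k Λ).right i) * x)
          = (ℛ k Λ).left i * aS k U ((ℛ k Λ).right i) * x := by
        intro i _
        rw [hpid (aS k U ((ℛ k Λ).right i) * x) (I.smul_mem _ hx), mul_assoc]
      rw [Finset.sum_congr rfl this, ← Finset.sum_mul,
        sum_mul_antipode_eq_algebraMap_counit, hΛ.eps]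
      simp
    let Q : U →ₗ[U] I :=
      { toFun := fun x => ⟨q x, hqI x⟩
        map_add' := fun x y => Subtype.ext (by simp [q, mul_add, Finset.sum_add_distrib])
        map_smul' := fun h x => Subtype.ext (by simp [hqlin]) }
    refine ⟨LinearMap.ker Q, ?_⟩
    exact LinearMap.isCompl_of_proj (f := Q) fun x => Subtype.ext (hqid x x.2)
  exact (isSemisimpleModule_iff U U).2 this

lemma TwoInt.dualone (hΛ : TwoInt k Λ) :
    ∑ i ∈ (ℛ k Λ).index, _root_.lamb k U (aS k U ((ℛ k Λ).right i)) • (ℛ k Λ).left i = 1 := by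
  apply hΛ.aS_inj
  have h1 := hΛ.leg1_lamb
  have h2 : comul (R := k) Λ = comul (R := k) (aS k U Λ) := by rw [hΛ.aS_eq]
  rw [h2, comul_aS, ← (ℛ k Λ).eq] at h1
  simp only [map_sum, TensorProduct.map_tmul, TensorProduct.comm_tmul, leg1_tmul] at h1
  rw [map_sum]
  simp only [map_smul]
  rw [h1]; simp

lemma TwoInt.trace_eq (hΛ : TwoInt k Λ) (f : Module.End k U) :
    LinearMap.trace k U f = ∑ i ∈ (ℛ k Λ).index,
      _root_.lamb k U (aS k U ((ℛ k Λ).right i) * f ((ℛ k Λ).left i)) := by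
  have hx : ∀ x, x = ∑ i ∈ (ℛ k Λ).index,
      _root_.lamb k U (aS k U ((ℛ k Λ).right i) * x) • (ℛ k Λ).left i := by
    intro x
    have := hΛ.cas ((LinearMap.lsmul k U ∘ₗ _root_.lamb k U).flip) x
    simp only [LinearMap.flip_apply, LinearMap.comp_apply, LinearMap.lsmul_apply] at this
    rw [← this]
    simp only [← mul_smul_comm, ← Finset.mul_sum]
    rw [hΛ.dualone, mul_one]
  have hf : f = ∑ i ∈ (ℛ k Λ).index,
      (_root_.lamb k U ∘ₗ LinearMap.mulLeft k (aS k U ((ℛ k Λ).right i))).smulRight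
        (f ((ℛ k Λ).left i)) := by
    ext x
    conv_lhs => rw [hx x, map_sum]
    simp
  conv_lhs => rw [hf, map_sum]
  simp [LinearMap.trace_smulRight]

variable (k U) in
/-- the character of the regular representation -/
def chiR : U →ₗ[k] k := LinearMap.trace k U ∘ₗ LinearMap.mul k U

lemma chiR_apply (x : U) : chiR k U x = LinearMap.trace k U (LinearMap.mulLeft k x) := rfl

lemma TwoInt.chi (hΛ : TwoInt k Λ) : chiR k U Λ = 1 := by
  rw [chiR_apply]
  have : LinearMap.mulLeft k Λ = (counit (R := k) (A := U)).smulRight Λ := by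
    ext x
    simp [hΛ.right]
  rw [this, LinearMap.trace_smulRight, hΛ.eps]

lemma chi_chi (x : U) : chiR k U (leg1 (chiR k U) (comul x))
    = (Module.finrank k U : k) * chiR k U x := by
  have h1 : ∀ t : U ⊗[k] U, chiR k U (leg1 (chiR k U) t)
      = LinearMap.trace k (U ⊗[k] U) (LinearMap.mulLeft k t) := by
    intro t
    induction t with
    | zero => simp
    | add a b ha hb =>
      have : LinearMap.mulLeft k (a + b) = LinearMap.mulLeft k a + LinearMap.mulLeft k b := by
        apply LinearMap.ext; intro y; simp [add_mul]
      rw [map_add, map_add, this, map_add, ha, hb]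
    | tmul a b =>
      have : LinearMap.mulLeft k (a ⊗ₜ[k] b) = TensorProduct.map (LinearMap.mulLeft k a)
          (LinearMap.mulLeft k b) := by
        ext; simp
      rw [this, LinearMap.trace_tensorProduct', leg1_tmul, map_smul]; rfl
  rw [h1]
  let Ψ : Module.End k (U ⊗[k] U) := LinearMap.mul' k (U ⊗[k] U) ∘ₗ
    TensorProduct.map (dl k U).toLinearMap (i2 k U).toLinearMap
  have hΨ : ∀ a b, Ψ (a ⊗ₜ b) = comul (R := k) a * (1 ⊗ₜ b) := by intro a b; simp [Ψ]
  have hsurj : Function.Surjective Ψ := by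
    rw [← LinearMap.range_eq_top, eq_top_iff, ← TensorProduct.span_tmul_eq_top, Submodule.span_le]
    rintro _ ⟨a, b, rfl⟩
    refine ⟨∑ i ∈ (ℛ k a).index, (ℛ k a).left i ⊗ₜ (aS k U ((ℛ k a).right i) * b), ?_⟩
    have h2 := LinearMap.congr_fun (K2 (k := k) (U := U)) a
    rw [cv_apply (ℛ k a)] at h2
    have h3 : (a ⊗ₜ[k] b : U ⊗[k] U) = (i1 k U).toLinearMap a * (1 ⊗ₜ b) := by simp
    rw [h3, ← h2, Finset.sum_mul, map_sum]
    refine Finset.sum_congr rfl fun i _ => ?_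
    rw [hΨ]
    simp [mul_assoc]
  have hbij : Function.Bijective Ψ := ⟨LinearMap.injective_iff_surjective.2 hsurj, hsurj⟩
  let e := LinearEquiv.ofBijective Ψ hbij
  have hconj : LinearMap.mulLeft k (comul (R := k) x)
      = e.conj (TensorProduct.map (LinearMap.mulLeft k x) LinearMap.id) := by
    apply LinearMap.ext
    intro y
    obtain ⟨y, rfl⟩ := e.surjective y
    rw [LinearEquiv.conj_apply]
    simp only [LinearMap.comp_apply, LinearEquiv.coe_coe, LinearEquiv.symm_apply_apply]
    change comul (R := k) x * Ψ y = Ψ _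
    induction y with
    | zero => simp
    | add a b ha hb => simp only [map_add, mul_add, ha, hb]
    | tmul a b => simp [hΨ, mul_assoc]
  rw [hconj, LinearMap.trace_conj', LinearMap.trace_tensorProduct', LinearMap.trace_id, mul_comm]
  rfl

variable (k U) in
/-- the idempotent `x ↦ D⁻¹ χ(x₁) x₂` -/
def Eop : Module.End k U := (Module.finrank k U : k)⁻¹ • (leg1 (chiR k U) ∘ₗ comul)

lemma leg1_leg1 (p q : U →ₗ[k] k) (h : U) :
    leg1 q (comul (leg1 p (comul h))) = leg1 (q ∘ₗ leg1 p ∘ₗ comul) (comul h) := by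
  have h1 := Coalgebra.coassoc_apply (R := k) h
  let T : U ⊗[k] (U ⊗[k] U) →ₗ[k] U := leg1 q ∘ₗ (TensorProduct.lid k (U ⊗[k] U)).toLinearMap ∘ₗ
    p.rTensor (U ⊗[k] U)
  have h2 := congrArg T h1
  have e1 : ∀ t : U ⊗[k] U, T (comul.lTensor U t) = leg1 q (comul (leg1 p t)) := by
    intro t
    induction t with
    | zero => simp
    | add a b ha hb => simp only [map_add, ha, hb]
    | tmul a b => simp [T]
  have e2 : ∀ t : U ⊗[k] U, T (TensorProduct.assoc k U U U (comul.rTensor U t))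
      = leg1 (q ∘ₗ leg1 p ∘ₗ comul) t := by
    intro t
    induction t with
    | zero => simp
    | add a b ha hb => simp only [map_add, ha, hb]
    | tmul a b =>
      simp only [LinearMap.rTensor_tmul, leg1_tmul, LinearMap.comp_apply]
      generalize comul (R := k) a = s
      induction s with
      | zero => simp
      | add a b ha hb => simp only [map_add, ha, hb, add_smul, TensorProduct.add_tmul]
      | tmul c d => simp [T, smul_smul, mul_comm]
  rw [← e1, ← h2, e2]

lemma Eop_idem [CharZero k] [Nontrivial U] : Eop k U * Eop k U = Eop k U := by
  have hD : (Module.finrank k U : k) ≠ 0 := by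
    exact_mod_cast (Module.finrank_pos (R := k) (M := U)).ne'
  ext x
  simp only [Eop, Module.End.mul_apply, LinearMap.smul_apply, LinearMap.comp_apply, map_smul]
  rw [leg1_leg1]
  have : chiR k U ∘ₗ leg1 (chiR k U) ∘ₗ comul = (Module.finrank k U : k) • chiR k U := by
    ext y
    simp [chi_chi]
  rw [this]
  have h2 : ∀ t, leg1 ((Module.finrank k U : k) • chiR k U) t
      = (Module.finrank k U : k) • leg1 (chiR k U) t := by
    intro t; simp [leg1, LinearMap.rTensor_smul]
  rw [h2, smul_smul, smul_smul]
  congr 1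
  field_simp

lemma chi_sS (hs : Function.Bijective (sS k U)) (x : U) : chiR k U (sS k U x) = chiR k U x := by
  let e := LinearEquiv.ofBijective (sS k U) hs
  have : LinearMap.mulLeft k (sS k U x) = e.conj (LinearMap.mulLeft k x) := by
    apply LinearMap.ext
    intro y
    obtain ⟨y, rfl⟩ := e.surjective y
    rw [LinearEquiv.conj_apply]
    simp only [LinearMap.comp_apply, LinearEquiv.coe_coe, LinearEquiv.symm_apply_apply]
    change sS k U x * sS k U y = sS k U (x * y)
    rw [sS_mul]
  rw [chiR_apply, this, LinearMap.trace_conj', chiR_apply]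

lemma Eop_comm (hs : Function.Bijective (sS k U)) : Commute (sS k U) (Eop k U) := by
  have : ∀ t : U ⊗[k] U, leg1 (chiR k U) (TensorProduct.map (sS k U) (sS k U) t)
      = sS k U (leg1 (chiR k U) t) := by
    intro t
    induction t with
    | zero => simp
    | add a b ha hb => simp only [map_add, ha, hb]
    | tmul a b => simp [chi_sS hs]
  change sS k U * Eop k U = Eop k U * sS k U
  ext x
  simp only [Eop, Module.End.mul_apply, LinearMap.smul_apply, LinearMap.comp_apply, map_smul,
    comul_sS, this]

lemma trace_sS : LinearMap.trace k U (sS k U) = lamb k U 1 := by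
  rw [lamb_apply]
  congr 1
  ext x
  simp [Zm_apply]

lemma TwoInt.trace_sS_E (hΛ : TwoInt k Λ) :
    LinearMap.trace k U (sS k U * Eop k U)
      = (Module.finrank k U : k)⁻¹ * LinearMap.trace k U (sS k U) := by
  rw [hΛ.trace_eq, trace_sS]
  let T : U ⊗[k] (U ⊗[k] U) →ₗ[k] k := LinearMap.mul' k k ∘ₗ TensorProduct.map (chiR k U)
    (_root_.lamb k U ∘ₗ aS k U ∘ₗ LinearMap.mul' k U ∘ₗ (aS k U).rTensor U)
  have h2 := congrArg T (Coalgebra.coassoc_apply (R := k) Λ)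
  have e1 : T (comul.lTensor U (comul (R := k) Λ)) = _root_.lamb k U 1 := by
    have : ∀ t : U ⊗[k] U, T (comul.lTensor U t)
        = chiR k U (leg2 (counit (R := k)) t) * _root_.lamb k U 1 := by
      intro t
      induction t with
      | zero => simp
      | add a b ha hb => simp only [map_add, ha, hb, add_mul]
      | tmul a b =>
        have h := LinearMap.congr_fun (mul_antipode_rTensor_comul (R := k) (A := U)) b
        simp only [LinearMap.comp_apply] at h
        simp [T, h, Algebra.algebraMap_eq_smul_one]
        ring
    rw [this, leg2_counit, hΛ.chi, one_mul]
  have e2 : ∀ t : U ⊗[k] U, T (TensorProduct.assoc k U U U (comul.rTensor U t))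
      = (_root_.lamb k U ∘ₗ LinearMap.mul' k U ∘ₗ (TensorProduct.map (aS k U)
          (sS k U ∘ₗ leg1 (chiR k U) ∘ₗ comul)) ∘ₗ (TensorProduct.comm k U U).toLinearMap) t := by
    intro t
    induction t with
    | zero => simp
    | add a b ha hb => simp only [map_add, ha, hb]
    | tmul a b =>
      simp only [LinearMap.rTensor_tmul, LinearMap.comp_apply, LinearEquiv.coe_coe,
        TensorProduct.comm_tmul, TensorProduct.map_tmul]
      generalize comul (R := k) a = s
      induction s with
      | zero => simp
      | add a b ha hb => simp only [map_add, ha, hb, TensorProduct.add_tmul, TensorProduct.tmul_add]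
      | tmul c d => simp [T, sS_apply, antipode_mul_antidistrib]
  rw [e1, e2, ← (ℛ k Λ).eq, map_sum] at h2
  rw [← h2, Finset.mul_sum]
  refine Finset.sum_congr rfl fun i _ => ?_
  simp [Eop]

lemma TwoInt.sS_eq_one [CharZero k] [IsAlgClosed k] [Nontrivial U] (hΛ : TwoInt k Λ) :
    sS k U = 1 := by
  obtain ⟨N, hN, hT⟩ := hΛ.sS_fin
  have hbij : Function.Bijective (sS k U) :=
    ⟨hΛ.sS_inj, LinearMap.injective_iff_surjective.1 hΛ.sS_inj⟩
  have : IsSemisimpleRing U := hΛ.maschke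
  have hD : (Module.finrank k U : k) ≠ 0 := by
    exact_mod_cast (Module.finrank_pos (R := k) (M := U)).ne'
  have hne : LinearMap.trace k U (sS k U) ≠ 0 := by
    refine wed_nonvanish' (sS k U) (_root_.lamb k U) hN hT hΛ.nak (fun h => rfl) ?_ ?_
    · intro b hb
      have : sS k U b = 0 := by
        have h1 := hΛ.leg1_S (aS k U b)
        rw [← leg1_comp_mulLeft] at h1
        have h2 : _root_.lamb k U ∘ₗ LinearMap.mulLeft k (aS k U (aS k U b)) = 0 := by
          ext x
          exact (hΛ.nak b x).trans (hb x)
        rw [h2] at h1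
        have h3 : aS k U b = 0 := by rw [← h1]; simp [leg1]
        rw [sS_apply]
        simp [h3]
      exact hΛ.sS_inj (by rw [this, map_zero])
    · intro h0
      have := hΛ.lamb
      rw [h0] at this
      simp at this
  have hNZ : NeZero N := ⟨hN.ne'⟩
  obtain ⟨z, hz⟩ : ∃ z : CyclotomicField N ℚ, IsPrimitiveRoot z N := exists_zeta N
  let f : CyclotomicField N ℚ →+* k :=
    (IsAlgClosed.lift (R := ℚ) (S := CyclotomicField N ℚ) (M := k)).toRingHom
  have hfz : IsPrimitiveRoot (f z) N := hz.map_of_injective f.injective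
  let m : ℕ → ℕ := mPr (f z) N (sS k U) 1
  let m' : ℕ → ℕ := mPr (f z) N (sS k U) (Eop k U)
  have t0 := trace_pow_mul hN hfz hT (one_mul 1) (Commute.one_right _) 0
  have t1 := trace_pow_mul hN hfz hT (one_mul 1) (Commute.one_right _) 1
  have t2 := trace_pow_mul hN hfz hT Eop_idem (Eop_comm hbij) 1
  simp only [pow_zero, one_mul, mul_one, pow_one] at t0 t1 t2
  rw [hΛ.trace_sS_E] at t2
  have hf1 : f (∑ j ∈ Finset.range N, (m j : CyclotomicField N ℚ) * z ^ j)
      = LinearMap.trace k U (sS k U) := by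
    rw [t1]; simp [m]
  have hf2 : f (∑ j ∈ Finset.range N, (m' j : CyclotomicField N ℚ) * z ^ j)
      = (Module.finrank k U : k)⁻¹ * LinearMap.trace k U (sS k U) := by
    rw [t2]; simp [m']
  have hqm : ∀ j, m j = 0 → qPr (f z) N (sS k U) j = 0 := by
    intro j hj
    have h1 : Module.finrank k (LinearMap.range (qPr (f z) N (sS k U) j * 1)) = 0 := hj
    rw [Submodule.finrank_eq_zero, mul_one, LinearMap.range_eq_bot] at h1
    exact h1
  have hm0 : 0 < m 0 := by
    rw [Nat.pos_iff_ne_zero]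
    intro h0
    have h1 := hqm 0 h0
    have h2 : ∀ i, (sS k U ^ i) 1 = 1 := by
      intro i
      induction i with
      | zero => simp
      | succ i ih => rw [pow_succ, Module.End.mul_apply, sS_one, ih]
    have h3 := LinearMap.congr_fun h1 (1 : U)
    simp only [qPr, pow_zero, one_smul, LinearMap.smul_apply, LinearMap.sum_apply, h2,
      Finset.sum_const, Finset.card_range, LinearMap.zero_apply] at h3
    rw [← Nat.cast_smul_eq_nsmul k, smul_smul, inv_mul_cancel₀ (by exact_mod_cast hN.ne'),
      one_smul] at h3
    exact one_ne_zero h3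
  have hsum : ∑ j ∈ Finset.range N, m j = Module.finrank k U := by
    have h1 : LinearMap.trace k U (1 : Module.End k U) = (Module.finrank k U : k) :=
      LinearMap.trace_one k U
    rw [h1] at t0
    have : ((∑ j ∈ Finset.range N, m j : ℕ) : k) = (Module.finrank k U : k) := by
      rw [t0]; simp [m]
    exact_mod_cast this
  have hall := final_roots hN hz m m' _ hsum hm0
    (f.injective (by rw [map_mul, hf1, hf2, map_natCast, mul_inv_cancel_left₀ hD]))
    (fun h0 => hne (by rw [← hf1, h0, map_zero]))
  have hq := sum_qPr (T := sS k U) hN hfz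
  rw [Finset.sum_eq_single_of_mem 0 (Finset.mem_range.2 hN)
    (fun j hj hj0 => hqm j (hall j (Finset.mem_range.1 hj) hj0))] at hq
  have h2 := mul_qPr hN hfz hT 0
  rw [hq, mul_one, pow_zero, one_smul] at h2
  exact h2
end Radford

section SSq
open Coalgebra HopfAlgebra

lemma exists_twoInt {k U : Type} [Field k] [Ring U] [HopfAlgebra k U] [IsSemisimpleRing U] :
    ∃ Λ : U, TwoInt k Λ := by
  let I : Submodule U U :=
    { carrier := {x | counit (R := k) x = 0}
      add_mem' := fun {a b} ha hb => by
        simp only [Set.mem_setOf_eq] at *; rw [map_add, ha, hb, add_zero]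
      zero_mem' := map_zero _
      smul_mem' := fun c x hx => by
        simp only [Set.mem_setOf_eq] at *
        rw [smul_eq_mul, Bialgebra.counit_mul, hx, mul_zero] }
  have memI : ∀ x, x ∈ I ↔ counit (R := k) x = 0 := fun x => Iff.rfl
  obtain ⟨C, hC⟩ := exists_isCompl I
  obtain ⟨n, hn, Λ, hΛ, h1⟩ := Submodule.mem_sup.1 (hC.sup_eq_top ▸ Submodule.mem_top :
    (1 : U) ∈ I ⊔ C)
  have eps : counit (R := k) Λ = 1 := by
    have := congrArg (counit (R := k)) h1
    rw [map_add, (memI n).1 hn, zero_add, Bialgebra.counit_one] at this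
    exact this
  have z : ∀ x, counit (R := k) x = 0 → x * Λ = 0 := by
    intro x hx
    have h2 : x * Λ ∈ I ⊓ C := ⟨by rw [SetLike.mem_coe, memI, Bialgebra.counit_mul, hx, zero_mul], C.smul_mem x hΛ⟩
    rw [hC.inf_eq_bot] at h2
    exact h2
  have left : ∀ h, h * Λ = counit (R := k) h • Λ := by
    intro h
    have := z (h - algebraMap k U (counit (R := k) h)) (by
      rw [map_sub, Bialgebra.counit_algebraMap, sub_self])
    rw [sub_mul, sub_eq_zero] at this
    rw [this, Algebra.smul_def]
  have z2 : ∀ x, counit (R := k) x = 0 → Λ * x = 0 := by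
    intro x hx
    set Lx := Λ * x
    obtain ⟨D, hD⟩ := exists_isCompl (Submodule.span U {Lx})
    obtain ⟨n, hn, c, hc, h1⟩ := Submodule.mem_sup.1 (hD.sup_eq_top ▸ Submodule.mem_top :
      (1 : U) ∈ Submodule.span U {Lx} ⊔ D)
    obtain ⟨a, rfl⟩ := Submodule.mem_span_singleton.1 hn
    have hz : Lx * (a • Lx) = 0 := by
      have : Lx * (a • Lx) = Λ * ((x * a) * Λ) * x := by simp only [Lx, smul_eq_mul, mul_assoc]
      rw [this, left, Bialgebra.counit_mul, hx, zero_mul, zero_smul, mul_zero, zero_mul]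
    have h2 : Lx = Lx * c := by
      have := congrArg (Lx * ·) h1
      simp only [mul_add, hz, zero_add, mul_one] at this
      exact this.symm
    have h3 : Lx ∈ Submodule.span U {Lx} ⊓ D :=
      ⟨Submodule.mem_span_singleton_self _, by
        have := D.smul_mem Lx hc
        rw [smul_eq_mul, ← h2] at this; exact this⟩
    rw [hD.inf_eq_bot] at h3
    exact h3
  refine ⟨Λ, left, fun h => ?_, eps⟩
  have := z2 (h - algebraMap k U (counit (R := k) h)) (by
      rw [map_sub, Bialgebra.counit_algebraMap, sub_self])
  rw [mul_sub, sub_eq_zero] at this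
  rw [this, Algebra.smul_def, Algebra.commutes]

lemma antipode_sq {k U : Type} [Field k] [CharZero k] [Ring U] [HopfAlgebra k U]
    [FiniteDimensional k U] [IsSemisimpleRing U] (x : U) : antipode k (antipode k x) = x := by
  obtain ⟨Λ, hΛ⟩ := exists_twoInt (k := k) (U := U)
  have nt : Nontrivial U := by
    refine ⟨Λ, 0, fun h => ?_⟩
    have := hΛ.eps
    rw [h, map_zero] at this
    exact zero_ne_one this
  let K := AlgebraicClosure k
  have : CharZero K := charZero_of_injective_algebraMap (algebraMap k K).injective
  have inj : Function.Injective (fun y : U => (1 : K) ⊗ₜ[k] y) :=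
    Algebra.TensorProduct.includeRight_injective (algebraMap k K).injective
  have nt2 : Nontrivial (K ⊗[k] U) := inj.nontrivial
  have hK : TwoInt K ((1 : K) ⊗ₜ[k] Λ) := by
    refine ⟨fun h => ?_, fun h => ?_, ?_⟩
    · induction h with
      | zero => simp
      | add a b ha hb => rw [add_mul, ha, hb, map_add, add_smul]
      | tmul a b =>
        rw [Algebra.TensorProduct.tmul_mul_tmul, hΛ.left, TensorProduct.counit_tmul,
          TensorProduct.tmul_smul, TensorProduct.smul_tmul', TensorProduct.smul_tmul']
        simp
    · induction h with
      | zero => simp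
      | add a b ha hb => rw [mul_add, ha, hb, map_add, add_smul]
      | tmul a b =>
        rw [Algebra.TensorProduct.tmul_mul_tmul, hΛ.right, TensorProduct.counit_tmul,
          TensorProduct.tmul_smul, TensorProduct.smul_tmul', TensorProduct.smul_tmul']
        simp
    · rw [TensorProduct.counit_tmul, hΛ.eps]; simp
  have h1 := LinearMap.congr_fun hK.sS_eq_one ((1 : K) ⊗ₜ[k] x)
  rw [sS_apply, TensorProduct.antipode_def] at h1
  simp only [TensorProduct.AlgebraTensorModule.map_tmul, Module.End.one_apply] at h1
  apply inj
  simpa using h1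
end SSq

section JStable
open Coalgebra HopfAlgebra

section
variable {k B : Type} [Field k] [CharZero k] [Ring B] [Algebra k B] [FiniteDimensional k B]

lemma exists_idem_of_elt (k : Type) {B : Type} [Field k] [Ring B] [Algebra k B]
    [FiniteDimensional k B] (y : B) : ∃ (c e : B), e = c * y ∧ e * e = e ∧ (e = 0 → IsNilpotent y) := by
  have hyint : IsIntegral k y := Algebra.IsIntegral.isIntegral y
  have hm : minpoly k y ≠ 0 := minpoly.ne_zero hyint
  obtain ⟨q, hq, hnd⟩ := Polynomial.exists_eq_pow_rootMultiplicity_mul_and_not_dvd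
    (minpoly k y) hm 0
  set n := (minpoly k y).rootMultiplicity 0
  rw [map_zero, sub_zero] at hq hnd
  have hcop : IsCoprime ((Polynomial.X : Polynomial k) ^ (n + 1)) q := by
    apply IsCoprime.pow_left
    exact (Polynomial.irreducible_X.coprime_iff_not_dvd).2 hnd
  obtain ⟨u, w, huw⟩ := hcop
  have h0 : y ^ n * Polynomial.aeval y q = 0 := by
    have := minpoly.aeval k y
    rw [hq] at this
    simpa using this
  have h1 : Polynomial.aeval y u * y ^ (n + 1) + Polynomial.aeval y w * Polynomial.aeval y q = 1 := by
    have := congrArg (Polynomial.aeval y) huw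
    simpa using this
  have com : ∀ a b : Polynomial k, Polynomial.aeval y a * Polynomial.aeval y b
      = Polynomial.aeval y b * Polynomial.aeval y a := fun a b => by
    rw [← map_mul, ← map_mul, mul_comm]
  have comy : ∀ (a : Polynomial k) (i : ℕ), y ^ i * Polynomial.aeval y a
      = Polynomial.aeval y a * y ^ i := fun a i => by
    have := com (Polynomial.X ^ i) a
    simpa using this
  set U := Polynomial.aeval y u
  set W := Polynomial.aeval y w
  set Q := Polynomial.aeval y q
  have hz : y ^ n * (W * Q) = 0 := by
    rw [← mul_assoc, comy, mul_assoc, h0, mul_zero]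
  have hz1 : y ^ (n + 1) * (W * Q) = 0 := by
    rw [pow_succ', mul_assoc, hz, mul_zero]
  refine ⟨U * y ^ n, U * y ^ (n + 1), by rw [pow_succ, mul_assoc], ?_, fun h => ?_⟩
  · calc _ = U * y ^ (n + 1) * (U * y ^ (n + 1) + W * Q) := by
          rw [mul_add, mul_assoc U _ (W * Q), hz1, mul_zero, add_zero]
      _ = _ := by rw [h1, mul_one]
  · refine ⟨n, ?_⟩
    calc y ^ n = y ^ n * (U * y ^ (n + 1) + W * Q) := by rw [h1, mul_one]
      _ = 0 := by rw [h, zero_add, hz]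

variable (k B) in
/-- trace of left multiplication -/
def trL : B →ₗ[k] k := LinearMap.trace k B ∘ₗ LinearMap.mul k B

lemma trL_comm (a b : B) : trL k B (a * b) = trL k B (b * a) := by
  have e : ∀ a b : B, LinearMap.mul k B (a * b) = LinearMap.mul k B a * LinearMap.mul k B b := by
    intro a b; ext c; simp [mul_assoc]
  simp only [trL, LinearMap.comp_apply, e]
  exact LinearMap.trace_mul_comm _ _ _

lemma trL_idem (e : B) (he : e * e = e) (ht : trL k B e = 0) : e = 0 := by
  have h1 := trace_idem (k := k) (LinearMap.mul k B e) (by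
    ext c; simp only [Module.End.mul_apply, LinearMap.mul_apply', ← mul_assoc, he])
  have h2 : (Module.finrank k (LinearMap.range (LinearMap.mul k B e)) : k) = 0 := by
    rw [← h1]; exact ht
  have h3 : Module.finrank k (LinearMap.range (LinearMap.mul k B e)) = 0 := by exact_mod_cast h2
  have h4 := Submodule.finrank_eq_zero.1 h3
  have h5 : LinearMap.mul k B e 1 ∈ LinearMap.range (LinearMap.mul k B e) := ⟨1, rfl⟩
  rw [h4] at h5
  simpa using h5

lemma mem_jac_iff (x : B) : x ∈ (⊥ : Ideal B).jacobson ↔ ∀ a, trL k B (x * a) = 0 := by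
  have : IsArtinianRing B := IsArtinianRing.of_finite k B
  constructor
  · intro hx a
    obtain ⟨n, hn⟩ := IsArtinianRing.isNilpotent_jacobson_bot (R := B)
    have h1 : x * a ∈ (⊥ : Ideal B).jacobson := Ideal.mul_mem_right a _ hx
    have h2 : IsNilpotent (x * a) := ⟨n, by
      have := Ideal.pow_mem_pow h1 n
      rw [hn] at this
      exact this⟩
    have h3 : IsNilpotent (LinearMap.mul k B (x * a)) := by
      obtain ⟨m, hm⟩ := h2
      refine ⟨m, ?_⟩
      have : ∀ m, (LinearMap.mul k B (x * a)) ^ m = LinearMap.mul k B ((x * a) ^ m) := by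
        intro m
        induction m with
        | zero => ext; simp
        | succ m ih => ext c; rw [pow_succ, ih, pow_succ]; simp [mul_assoc]
      rw [this, hm, map_zero]
    exact (LinearMap.isNilpotent_trace_of_isNilpotent h3).eq_zero
  · intro hx
    rw [Ideal.mem_jacobson_iff]
    intro y
    have hnil : IsNilpotent (y * x) := by
      obtain ⟨c, e, he, hee, h0⟩ := exists_idem_of_elt k (y * x)
      apply h0
      apply trL_idem (k := k) e hee
      rw [he, ← mul_assoc, trL_comm, hx]
    obtain ⟨z, hz⟩ := hnil.isUnit_one_add
    refine ⟨↑z⁻¹, ?_⟩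
    have : (↑z⁻¹ : B) * (1 + y * x) = 1 := by rw [← hz]; simp
    rw [mul_add, mul_one] at this
    rw [Ideal.mem_bot, mul_assoc, add_comm, this, sub_self]
end

section
variable {k U B : Type} [Field k] [Ring U] [HopfAlgebra k U] [Ring B] [Algebra k B]

lemma HMA.act_mul_sum (M : HMA k U B) (h : U) (a b : B) :
    M.act h (a * b) = ∑ i ∈ (ℛ k h).index, M.act ((ℛ k h).left i) a * M.act ((ℛ k h).right i) b := by
  have := LinearMap.congr_fun M.act_mul_compat (h ⊗ₜ (a ⊗ₜ b))
  simp only [LinearMap.comp_apply, LinearMap.lTensor_tmul, LinearMap.mul'_apply,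
    TensorProduct.lift.tmul, LinearMap.rTensor_tmul] at this
  rw [this]
  conv_lhs => rw [← (ℛ k h).eq]
  simp [TensorProduct.sum_tmul]

/-- the action as an algebra map -/
def HMA.rho (M : HMA k U B) : U →ₐ[k] Module.End k B :=
  AlgHom.ofLinearMap M.act M.act_one M.act_mul

lemma HMA.rho_apply (M : HMA k U B) (h : U) (a : B) : M.rho h a = M.act h a := rfl

/-- `h ↦ L_{h·a}` -/
def HMA.lam (M : HMA k U B) (a : B) : U →ₗ[k] Module.End k B :=
  LinearMap.mul k B ∘ₗ M.act.flip a

lemma HMA.lam_eq (M : HMA k U B) (a : B) (h : U) :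
    LinearMap.mul k B (M.act h a) = ∑ i ∈ (ℛ k h).index,
      M.rho ((ℛ k h).left i) * LinearMap.mul k B a * M.rho (antipode k ((ℛ k h).right i)) := by
  have h1 : cv (M.lam a) M.rho.toLinearMap
      = LinearMap.mulRight k (LinearMap.mul k B a) ∘ₗ M.rho.toLinearMap := by
    ext h c
    rw [cv_apply (ℛ k h)]
    simp only [LinearMap.sum_apply, Module.End.mul_apply, HMA.lam, LinearMap.comp_apply,
      LinearMap.flip_apply, LinearMap.mul_apply', AlgHom.toLinearMap_apply, HMA.rho_apply,
      LinearMap.mulRight_apply, HMA.act_mul_sum M h a c]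
  have h2 : cv (cv (M.lam a) M.rho.toLinearMap) (M.rho.toLinearMap ∘ₗ antipode k) = M.lam a := by
    rw [cv_assoc, cv_antipode_right, cv_cvone]
  rw [h1] at h2
  have h3 := LinearMap.congr_fun h2 h
  rw [cv_apply (ℛ k h)] at h3
  exact h3.symm

variable [CharZero k] [FiniteDimensional k U] [IsSemisimpleRing U] [FiniteDimensional k B]

lemma sum_anti_flip (h : U) :
    ∑ i ∈ (ℛ k h).index, antipode k ((ℛ k h).right i) * (ℛ k h).left i
      = algebraMap k U (counit (R := k) h) := by
  have h1 := sum_antipode_mul_eq_algebraMap_counit (R := k) (ℛ k h)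
  have h2 := congrArg (antipode k) h1
  rw [map_sum] at h2
  simp only [antipode_mul_antidistrib, antipode_sq] at h2
  rw [h2, Algebra.algebraMap_eq_smul_one, map_smul, antipode_one]

lemma HMA.trL_act (M : HMA k U B) (a : B) (h : U) :
    trL k B (M.act h a) = counit (R := k) h * trL k B a := by
  simp only [trL, LinearMap.comp_apply]
  rw [HMA.lam_eq, map_sum]
  have : ∀ i ∈ (ℛ k h).index, LinearMap.trace k B (M.rho ((ℛ k h).left i) * LinearMap.mul k B a *
      M.rho (antipode k ((ℛ k h).right i))) = LinearMap.trace k B (LinearMap.mul k B a *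
      M.rho (antipode k ((ℛ k h).right i) * (ℛ k h).left i)) := by
    intro i _
    rw [mul_assoc, LinearMap.trace_mul_comm, mul_assoc, map_mul M.rho]
  rw [Finset.sum_congr rfl this, ← map_sum, ← Finset.mul_sum, ← map_sum, sum_anti_flip,
    AlgHom.commutes, Algebra.algebraMap_eq_smul_one, mul_smul_comm, mul_one, map_smul, smul_eq_mul]

lemma HMA.act_mem_jac (M : HMA k U B) (h : U) {x : B} (hx : x ∈ (⊥ : Ideal B).jacobson) :
    M.act h x ∈ (⊥ : Ideal B).jacobson := by
  rw [mem_jac_iff (k := k)] at hx ⊢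
  intro a
  have h1 := LinearMap.congr_fun (M.lam_eq x h) a
  simp only [LinearMap.sum_apply, Module.End.mul_apply, LinearMap.mul_apply', HMA.rho_apply] at h1
  rw [h1, map_sum]
  apply Finset.sum_eq_zero
  intro i _
  rw [HMA.trL_act, hx, mul_zero]
end
end JStable

section Finale
open Coalgebra HopfAlgebra

section
variable {k U B : Type} [Field k] [Ring U] [HopfAlgebra k U] [Ring B] [Algebra k B]
variable {B2 : Type} [Ring B2] [Algebra k B2] {I : Type}

lemma HMA.eval_iota (M : HMA k U B) (v : I → B) (p : I →₀ k) (h : U) :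
    M.eval k U v (TensorAlgebra.ι k (p ⊗ₜ[k] h)) = M.act h (Finsupp.linearCombination k v p) := by
  simp [HMA.eval]

lemma HMA.eval_xvar (M : HMA k U B) (v : I → B) (i : I) (h : U) :
    M.eval k U v (xvar k U i h) = M.act h (v i) := by
  rw [xvar, HMA.eval_iota]; simp

lemma HMA.map_eval (M : HMA k U B) (M2 : HMA k U B2) (φ : B →ₐ[k] B2)
    (hφ : ∀ h x, φ (M.act h x) = M2.act h (φ x)) (v : I → B) (f : FreeHMA k U I) :
    φ (M.eval k U v f) = M2.eval k U (φ ∘ v) f := by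
  have : φ.comp (M.eval k U v) = M2.eval k U (φ ∘ v) := by
    apply TensorAlgebra.hom_ext
    apply TensorProduct.ext'
    intro p h
    simp only [LinearMap.comp_apply, AlgHom.toLinearMap_apply, AlgHom.comp_apply,
      HMA.eval_iota, hφ]
    congr 1
    simp only [Finsupp.linearCombination_apply, Finsupp.sum, map_sum, map_smul, Function.comp]
  exact DFunLike.congr_fun this f

lemma free_top (T : Subalgebra k (FreeHMA k U I)) (hT : ∀ i h, xvar k U i h ∈ T) : T = ⊤ := by
  rw [eq_top_iff, ← TensorAlgebra.adjoin_range_ι, Algebra.adjoin_le_iff]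
  rintro _ ⟨z, rfl⟩
  induction z with
  | zero => rw [map_zero]; exact T.zero_mem
  | add a b ha hb => rw [map_add]; exact T.add_mem ha hb
  | tmul p h =>
    induction p using Finsupp.induction_linear with
    | zero => rw [TensorProduct.zero_tmul, map_zero]; exact T.zero_mem
    | add a b ha hb => rw [TensorProduct.add_tmul, map_add]; exact T.add_mem ha hb
    | single i c =>
      have : (Finsupp.single i c : I →₀ k) = c • Finsupp.single i 1 := by simp
      rw [this, ← TensorProduct.smul_tmul', map_smul]
      exact T.smul_mem (hT i h) c

lemma coprod_top {R₀ : Type} [Ring R₀] [Algebra k R₀] {s : ℕ} (D : HCoprodData k U R₀ s)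
    (T : Subalgebra k D.B') (h1 : ∀ x, D.inclS x ∈ T) (h2 : ∀ x, D.inclX x ∈ T) (x : D.B') :
    x ∈ T := by
  obtain ⟨φ, ⟨hφ1, hφ2⟩, -⟩ := D.universal T (D.inclS.codRestrict T h1) (D.inclX.codRestrict T h2)
  obtain ⟨ψ, -, hψ⟩ := D.universal D.B' D.inclS D.inclX
  have e1 := hψ (T.val.comp φ) ⟨by rw [AlgHom.comp_assoc, hφ1]; rfl,
    by rw [AlgHom.comp_assoc, hφ2]; rfl⟩
  have e2 := hψ (AlgHom.id k D.B') ⟨rfl, rfl⟩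
  have := DFunLike.congr_fun (e1.trans e2.symm) x
  have h3 : ((φ x : T) : D.B') = x := this
  rw [← h3]; exact (φ x).2

/-- the subalgebra on which an algebra map is equivariant -/
def equivSub (M : HMA k U B) (M2 : HMA k U B2) (φ : B →ₐ[k] B2) : Subalgebra k B where
  carrier := {x | ∀ h, φ (M.act h x) = M2.act h (φ x)}
  add_mem' := fun {a b} ha hb h => by simp only [map_add, ha h, hb h]
  mul_mem' := fun {a b} ha hb h => by
    rw [HMA.act_mul_sum, map_sum, map_mul, HMA.act_mul_sum]
    refine Finset.sum_congr rfl fun i _ => ?_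
    rw [map_mul, ha, hb]
  algebraMap_mem' := fun c h => by
    rw [AlgHom.commutes, Algebra.algebraMap_eq_smul_one, Algebra.algebraMap_eq_smul_one,
      map_smul, map_smul, map_smul, M.act_algebraOne, M2.act_algebraOne, map_smul, map_one]

lemma mem_equivSub (M : HMA k U B) (M2 : HMA k U B2) (φ : B →ₐ[k] B2) (x : B) :
    x ∈ equivSub M M2 φ ↔ ∀ h, φ (M.act h x) = M2.act h (φ x) := Iff.rfl

/-- functions on finite sets given by inclusion-exclusion with a filtration condition -/
def polySub {ι : Type} [DecidableEq ι] (P : ℕ → Submodule k B) (htop : P 0 = ⊤)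
    (hanti : Antitone P) (hmul : ∀ m n x y, x ∈ P m → y ∈ P n → x * y ∈ P (m + n)) :
    Subalgebra k (Finset ι → B) where
  carrier := {G | ∃ Q : Finset ι → B, (∀ S, Q S ∈ P S.card) ∧
    ∀ T, G T = ∑ S ∈ T.powerset, Q S}
  add_mem' := by
    rintro G G' ⟨Q, h1, h2⟩ ⟨Q', h1', h2'⟩
    refine ⟨fun S => Q S + Q' S, fun S => add_mem (h1 S) (h1' S), fun T => ?_⟩
    rw [Pi.add_apply, h2, h2', Finset.sum_add_distrib]
  mul_mem' := by
    rintro G G' ⟨Q, h1, h2⟩ ⟨Q', h1', h2'⟩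
    refine ⟨fun S => ∑ p ∈ (S.powerset ×ˢ S.powerset).filter (fun p => p.1 ∪ p.2 = S),
      Q p.1 * Q' p.2, fun S => ?_, fun T => ?_⟩
    · refine Submodule.sum_mem _ fun p hp => ?_
      have h3 := (Finset.mem_filter.1 hp).2
      apply hanti _ (hmul _ _ _ _ (h1 p.1) (h1' p.2))
      rw [← h3]; exact Finset.card_union_le _ _
    · rw [Pi.mul_apply, h2, h2', Finset.sum_mul_sum, ← Finset.sum_product',
        ← Finset.sum_fiberwise_of_maps_to (s := T.powerset ×ˢ T.powerset) (t := T.powerset)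
          (g := fun p => p.1 ∪ p.2)]
      · refine Finset.sum_congr rfl fun S hS => Finset.sum_congr ?_ fun _ _ => rfl
        ext p
        simp only [Finset.mem_filter, Finset.mem_product, Finset.mem_powerset] at hS ⊢
        constructor
        · rintro ⟨-, rfl⟩
          exact ⟨⟨Finset.subset_union_left, Finset.subset_union_right⟩, rfl⟩
        · rintro ⟨⟨a, b⟩, c⟩
          exact ⟨⟨a.trans hS, b.trans hS⟩, c⟩
      · intro p hp
        simp only [Finset.mem_product, Finset.mem_powerset] at hp ⊢
        exact Finset.union_subset hp.1 hp.2
  algebraMap_mem' := fun c => by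
    refine ⟨fun S => if S = ∅ then algebraMap k B c else 0, fun S => ?_, fun T => ?_⟩
    · by_cases h : S = ∅
      · subst h; rw [Finset.card_empty, htop]; trivial
      · simp [h]
    · rw [Finset.sum_ite_eq' T.powerset ∅, if_pos (Finset.empty_mem_powerset T)]; rfl

lemma mem_polySub {ι : Type} [DecidableEq ι] (P : ℕ → Submodule k B) (htop : P 0 = ⊤)
    (hanti : Antitone P) (hmul : ∀ m n x y, x ∈ P m → y ∈ P n → x * y ∈ P (m + n))
    (G : Finset ι → B) : G ∈ polySub P htop hanti hmul ↔ ∃ Q : Finset ι → B,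
      (∀ S, Q S ∈ P S.card) ∧ ∀ T, G T = ∑ S ∈ T.powerset, Q S := Iff.rfl

lemma polySub_zero {ι : Type} [DecidableEq ι] (P : ℕ → Submodule k B) (htop : P 0 = ⊤)
    (hanti : Antitone P) (hmul : ∀ m n x y, x ∈ P m → y ∈ P n → x * y ∈ P (m + n))
    (G : Finset ι → B) (hG : G ∈ polySub P htop hanti hmul) (s : ℕ) (hs : P s = ⊥)
    (h0 : ∀ S, S.card < s → G S = 0) (T : Finset ι) : G T = 0 := by
  obtain ⟨Q, h1, h2⟩ := hG
  have hQ : ∀ S, Q S = 0 := by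
    intro S
    induction S using Finset.strongInduction with
    | H S ih =>
      by_cases h : S.card < s
      · have h3 := h2 S
        rw [h0 S h, Finset.sum_eq_single_of_mem S (Finset.mem_powerset_self S)] at h3
        · exact h3.symm
        · intro S' hS' hne
          exact ih S' (Finset.ssubset_iff_subset_ne.2 ⟨Finset.mem_powerset.1 hS', hne⟩)
      · have := hanti (not_lt.1 h) (h1 S)
        rw [hs] at this
        exact this
  rw [h2]; exact Finset.sum_eq_zero fun S _ => hQ S

lemma eval_mem_polySub {ι : Type} [DecidableEq ι] (P : ℕ → Submodule k B) (htop : P 0 = ⊤)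
    (hanti : Antitone P) (hmul : ∀ m n x y, x ∈ P m → y ∈ P n → x * y ∈ P (m + n))
    (M : HMA k U B) (hst : ∀ h, ∀ x ∈ P 1, M.act h x ∈ P 1)
    (a : I → B) (c : I → ι → k) (b : ι → B) (hb : ∀ i, b i ∈ P 1) (f : FreeHMA k U I) :
    (fun T : Finset ι => M.eval k U (fun n => a n + ∑ i ∈ T, c n i • b i) f)
      ∈ polySub P htop hanti hmul := by
  let E : FreeHMA k U I →ₐ[k] (Finset ι → B) :=
    AlgHom.pi fun T => M.eval k U (fun n => a n + ∑ i ∈ T, c n i • b i)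
  have hE : (polySub P htop hanti hmul).comap E = ⊤ := by
    apply free_top
    intro n h
    rw [Subalgebra.mem_comap, mem_polySub]
    refine ⟨fun S => (if S = ∅ then M.act h (a n) else 0) +
      ∑ i : S, if S = {i.1} then M.act h (c n i.1 • b i.1) else 0, fun S => ?_, fun T => ?_⟩
    · apply add_mem
      · by_cases h : S = ∅
        · subst h; rw [Finset.card_empty, htop]; trivial
        · simp [h]
      · refine Submodule.sum_mem _ fun i _ => ?_
        by_cases h' : S = {i.1}
        · have hc : S.card = 1 := by rw [Finset.card_eq_one]; exact ⟨_, h'⟩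
          rw [if_pos h', hc]
          exact hst h _ ((P 1).smul_mem _ (hb _))
        · rw [if_neg h']; exact zero_mem _
    · have : E (xvar k U n h) T = M.act h (a n) + ∑ i ∈ T, M.act h (c n i • b i) := by
        change M.eval k U (fun n => a n + ∑ i ∈ T, c n i • b i) (xvar k U n h) = _
        rw [HMA.eval_xvar, map_add, map_sum]
      rw [this, Finset.sum_add_distrib, Finset.sum_ite_eq' T.powerset ∅,
        if_pos (Finset.empty_mem_powerset T)]
      congr 1
      have : ∀ S ∈ T.powerset, (∑ i : S, if S = {i.1} then M.act h (c n i.1 • b i.1) else 0)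
          = ∑ i ∈ T, if S = {i} then M.act h (c n i • b i) else 0 := by
        intro S hS
        rw [Finset.sum_coe_sort S (fun i => if S = {i} then M.act h (c n i • b i) else 0)]
        apply Finset.sum_subset (Finset.mem_powerset.1 hS)
        intro i _ hi
        rw [if_neg]
        rintro rfl
        exact hi (Finset.mem_singleton_self i)
      rw [Finset.sum_congr rfl this, Finset.sum_comm]
      refine Finset.sum_congr rfl fun i hi => ?_
      rw [Finset.sum_ite_eq', if_pos (by simpa using hi)]
  have : f ∈ (polySub P htop hanti hmul).comap E := by rw [hE]; trivial
  exact this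
end

section
variable {k B : Type} [Field k] [Ring B] [Algebra k B]

variable (k B) in
/-- the filtration by powers of the radical -/
def jacFil (n : ℕ) : Submodule k B := (((⊥ : Ideal B).jacobson) ^ n).restrictScalars k

lemma jacFil_mul (m n : ℕ) (x y : B) (hx : x ∈ jacFil k B m) (hy : y ∈ jacFil k B n) :
    x * y ∈ jacFil k B (m + n) := by
  have : x * y ∈ ((⊥ : Ideal B).jacobson) ^ m * ((⊥ : Ideal B).jacobson) ^ n :=
    Ideal.mul_mem_mul hx hy
  rw [← Ideal.IsTwoSided.pow_add] at this
  exact this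

lemma jacFil_zero : jacFil k B 0 = ⊤ := by
  simp [jacFil]

lemma jacFil_one : jacFil k B 1 = jacRad k B := by
  rw [jacFil, jacRad, Submodule.pow_one]

lemma jacFil_anti : Antitone (jacFil k B) := by
  apply antitone_nat_of_succ_le
  intro n x hx
  have : ((⊥ : Ideal B).jacobson) ^ (n + 1) ≤ ((⊥ : Ideal B).jacobson) ^ n :=
    Ideal.pow_le_pow_right (Nat.le_succ n)
  exact this hx

lemma jacRad_pow_le (n : ℕ) : (jacRad k B) ^ n ≤ jacFil k B n := by
  induction n with
  | zero => rw [jacFil_zero]; exact le_top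
  | succ n ih =>
    rw [pow_succ, Submodule.mul_le]
    intro x hx y hy
    exact jacFil_mul n 1 x y (ih hx) (by rw [jacFil_one]; exact hy)

lemma jacFil_bot [FiniteDimensional k B] (s : ℕ) (hs : nilIndex B ≤ s) : jacFil k B s = ⊥ := by
  have : IsArtinianRing B := IsArtinianRing.of_finite k B
  obtain ⟨n, hn⟩ := IsArtinianRing.isNilpotent_jacobson_bot (R := B)
  have h1 : nilIndex B ∈ {n : ℕ | ((⊥ : Ideal B).jacobson) ^ n = ⊥} := Nat.sInf_mem ⟨n, hn⟩
  have h2 : jacFil k B (nilIndex B) = ⊥ := by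
    have h3 : ((⊥ : Ideal B).jacobson) ^ (nilIndex B) = ⊥ := h1
    rw [jacFil, h3]; rfl
  exact le_bot_iff.1 (h2 ▸ jacFil_anti hs)
end
end Finale

section Key
variable {k U : Type} [Field k] [Ring U] [HopfAlgebra k U] [CharZero k]
  [FiniteDimensional k U] [IsSemisimpleRing U]

lemma hIdealSpan_le {B : Type} [Ring B] [Algebra k B] (M : HMA k U B) (X : Set B)
    (J : Submodule k B) (h1 : X ⊆ J) (h2 : ∀ a : B, ∀ x ∈ J, a * x ∈ J ∧ x * a ∈ J)
    (h3 : ∀ h : U, ∀ x ∈ J, M.act h x ∈ J) : hIdealSpan k U M X ≤ J :=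
  sInf_le ⟨h1, h2, h3⟩

lemma subset_hIdealSpan {B : Type} [Ring B] [Algebra k B] (M : HMA k U B) (X : Set B)
    (x : B) (hx : x ∈ X) : x ∈ hIdealSpan k U M X := by
  rw [hIdealSpan, Submodule.mem_sInf]
  exact fun I hI => hI.1 hx

/-- The map from the coproduct given by the universal property, with all its properties. -/
lemma coprod_map {R₀ : Type} [Ring R₀] [Algebra k R₀] (MR : HMA k U R₀)
    {B : Type} [Ring B] [Algebra k B] (M : HMA k U B)
    (ψ : R₀ →ₐ[k] B) (hψ : ∀ h x, ψ (MR.act h x) = M.act h (ψ x))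
    {s : ℕ} (D : HCoprodData k U R₀ s)
    (hactS : ∀ (h : U) (x : R₀), D.M'.act h (D.inclS x) = D.inclS (MR.act h x))
    (hactX : ∀ (h g : U) (q : Fin s →₀ k),
      D.M'.act h (D.inclX (TensorAlgebra.ι k (q ⊗ₜ[k] g)))
        = D.inclX (TensorAlgebra.ι k (q ⊗ₜ[k] (h * g))))
    (b : Fin s → B) :
    ∃ φ : D.B' →ₐ[k] B, (∀ x, φ (D.inclS x) = ψ x) ∧
      (∀ f, φ (D.inclX f) = M.eval k U b f) ∧
      ∀ h x, φ (D.M'.act h x) = M.act h (φ x) := by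
  obtain ⟨φ, ⟨h1, h2⟩, -⟩ := D.universal B ψ (M.eval k U b)
  have h1' : ∀ x, φ (D.inclS x) = ψ x := fun x => DFunLike.congr_fun h1 x
  have h2' : ∀ f, φ (D.inclX f) = M.eval k U b f := fun f => DFunLike.congr_fun h2 f
  refine ⟨φ, h1', h2', fun h x => ?_⟩
  refine (mem_equivSub D.M' M φ x).1 (coprod_top D (equivSub D.M' M φ) (fun y => ?_) (fun f => ?_) x) h
  · rw [mem_equivSub]
    intro g
    rw [hactS, h1', h1', hψ]
  · have : (equivSub D.M' M φ).comap D.inclX = ⊤ := by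
      apply free_top
      intro i g
      rw [Subalgebra.mem_comap, mem_equivSub]
      intro h
      rw [xvar, hactX, h2', h2', HMA.eval_iota, HMA.eval_iota, M.act_mul]
      rfl
    have hf : f ∈ (equivSub D.M' M φ).comap D.inclX := by rw [this]; trivial
    exact hf

lemma key {R₀ : Type} [Ring R₀] [Algebra k R₀] (MR : HMA k U R₀)
    {B : Type} [Ring B] [Algebra k B] [FiniteDimensional k B] (M : HMA k U B)
    (ψ : R₀ →ₐ[k] B) (hψ : ∀ h x, ψ (MR.act h x) = M.act h (ψ x))
    (hcompl : IsCompl (Subalgebra.toSubmodule ψ.range) (jacRad k B))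
    {s : ℕ} (hs : nilIndex B ≤ s) (D : HCoprodData k U R₀ s)
    (hactS : ∀ (h : U) (x : R₀), D.M'.act h (D.inclS x) = D.inclS (MR.act h x))
    (hactX : ∀ (h g : U) (q : Fin s →₀ k),
      D.M'.act h (D.inclX (TensorAlgebra.ι k (q ⊗ₜ[k] g)))
        = D.inclX (TensorAlgebra.ι k (q ⊗ₜ[k] (h * g))))
    (Γ : Set (FreeHMA k U ℕ)) (hΓ : Γ ⊆ M.idSet k U ℕ)
    (I₁ I₂ : Submodule k D.B')
    (hI₁ : I₁ = hIdealSpan k U D.M'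
      {y | ∃ f ∈ Γ, ∃ v : ℕ → D.B', y = D.M'.eval k U v f})
    (hI₂ : I₂ = hIdealSpan k U D.M'
      {y | ∃ (i : Fin s) (h : U), y = D.inclX (xvar k U i h)})
    (f : FreeHMA k U ℕ) (hf : ∀ w : ℕ → D.B', D.M'.eval k U w f ∈ I₁ ⊔ I₂ ^ s) :
    f ∈ M.idSet k U ℕ := by
  classical
  intro v
  have hdec : ∀ n, ∃ (r : R₀) (x : jacRad k B), ψ r + x = v n := by
    intro n
    obtain ⟨y, ⟨r, hr⟩, x, hx, h⟩ := Submodule.mem_sup.1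
      (hcompl.sup_eq_top ▸ Submodule.mem_top :
        v n ∈ Subalgebra.toSubmodule ψ.range ⊔ jacRad k B)
    refine ⟨r, ⟨x, hx⟩, ?_⟩
    rw [← h, ← hr]; rfl
  choose r x hrx using hdec
  let bas := Module.finBasis k (jacRad k B)
  let ι := Fin (Module.finrank k (jacRad k B))
  let b : ι → B := fun i => (bas i : B)
  let c : ℕ → ι → k := fun n i => bas.repr (x n) i
  have hb : ∀ i, b i ∈ jacFil k B 1 := fun i => by rw [jacFil_one]; exact (bas i).2
  have hx : ∀ n, (x n : B) = ∑ i, c n i • b i := by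
    intro n
    have := congrArg Subtype.val (bas.sum_repr (x n))
    rw [← this, Submodule.coe_sum]; rfl
  have hst : ∀ h, ∀ y ∈ jacFil k B 1, M.act h y ∈ jacFil k B 1 := by
    intro h y hy
    rw [jacFil_one] at hy ⊢
    exact M.act_mem_jac h hy
  have hbot : jacFil k B s = ⊥ := jacFil_bot s hs
  have hG := eval_mem_polySub (jacFil k B) jacFil_zero jacFil_anti jacFil_mul M hst
    (fun n => ψ (r n)) c b hb f
  have hfin := polySub_zero _ _ _ _ _ hG s hbot ?_ Finset.univ
  · have hv : (fun n => ψ (r n) + ∑ i, c n i • b i) = v := by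
      funext n; rw [← hx, hrx]
    simp only [hv] at hfin
    exact hfin
  intro S hS
  have hcard : Fintype.card S ≤ Fintype.card (Fin s) := by simpa using hS.le
  obtain ⟨e⟩ := Function.Embedding.nonempty_of_card_le hcard
  let b' : Fin s → B := Function.extend e (fun i : S => b i.1) 0
  have hb' : ∀ j, b' j ∈ jacRad k B := by
    intro j
    by_cases h : ∃ i, e i = j
    · obtain ⟨i, rfl⟩ := h
      simp only [b', e.injective.extend_apply]
      rw [← jacFil_one]; exact hb _
    · simp only [b', Function.extend_apply' _ _ _ h]
      exact zero_mem _
  obtain ⟨φ, h1, h2, h3⟩ := coprod_map MR M ψ hψ D hactS hactX b'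
  let w : ℕ → D.B' := fun n => D.inclS (r n) +
    ∑ i : S, c n i.1 • D.inclX (xvar k U (e i) 1)
  have hw : (φ ∘ w) = fun n => ψ (r n) + ∑ i ∈ S, c n i • b i := by
    funext n
    simp only [Function.comp, w, map_add, h1, map_sum, map_smul, h2, HMA.eval_xvar, M.act_one,
      LinearMap.id_apply, b', e.injective.extend_apply]
    rw [Finset.sum_coe_sort S (fun i => c n i • b i)]
  change M.eval k U (fun n => ψ (r n) + ∑ i ∈ S, c n i • b i) f = 0
  rw [← hw, ← HMA.map_eval D.M' M φ h3]
  obtain ⟨y1, hy1, y2, hy2, hy⟩ := Submodule.mem_sup.1 (hf w)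
  rw [← hy, map_add]
  have z1 : φ y1 = 0 := by
    have : I₁ ≤ LinearMap.ker φ.toLinearMap := by
      rw [hI₁]
      apply hIdealSpan_le
      · rintro _ ⟨g, hg, u, rfl⟩
        change φ _ = 0
        rw [HMA.map_eval D.M' M φ h3]
        exact hΓ hg _
      · intro a y hy
        have hy' : φ y = 0 := hy
        constructor
        · change φ (a * y) = 0
          rw [map_mul, hy', mul_zero]
        · change φ (y * a) = 0
          rw [map_mul, hy', zero_mul]
      · intro h y hy
        have hy' : φ y = 0 := hy
        change φ _ = 0
        rw [h3, hy', map_zero]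
    exact this hy1
  have z2 : φ y2 = 0 := by
    have h4 : I₂ ≤ (jacRad k B).comap φ.toLinearMap := by
      rw [hI₂]
      apply hIdealSpan_le
      · rintro _ ⟨i, h, rfl⟩
        change φ _ ∈ jacRad k B
        rw [h2, HMA.eval_xvar]
        exact M.act_mem_jac h (hb' i)
      · intro a y hy
        have hy' : φ y ∈ (⊥ : Ideal B).jacobson := hy
        constructor
        · change φ (a * y) ∈ (⊥ : Ideal B).jacobson
          rw [map_mul]; exact Ideal.mul_mem_left _ _ hy'
        · change φ (y * a) ∈ (⊥ : Ideal B).jacobson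
          rw [map_mul]; exact Ideal.mul_mem_right _ _ hy'
      · intro h y hy
        have hy' : φ y ∈ (⊥ : Ideal B).jacobson := hy
        change φ _ ∈ (⊥ : Ideal B).jacobson
        rw [h3]; exact M.act_mem_jac h hy'
    have h5 : (I₂ ^ s).map φ.toLinearMap ≤ ⊥ := by
      have := Submodule.map_pow I₂ φ s
      rw [this, ← hbot]
      exact (pow_le_pow_left' (Submodule.map_le_iff_le_comap.2 h4) s).trans (jacRad_pow_le s)
    exact h5 ⟨y2, hy2, rfl⟩
  rw [z1, z2, add_zero]
end Key

/-- Let `A = Â₁ × ⋯ × Â_r × Ã` be a product of `H`-basic algebras,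
where `Â₁,...,Â_r` have Kemer index `p` and semisimple parts among a fixed list
`R₁,...,R_t` of `H`-semisimple algebras, and `Ã` is a product of `H`-basic algebras of
index less than `p`.  For `j = 1,...,t` define
`C_j = (R_j ∗ F^H⟨x₁,...,x_s⟩)/(id^H_{R_j ∗ F^H⟨x⟩}(A) + ⟨X⟩_H^s)`,
where `s - 1` bounds the nilpotency indices, and set `C = C₁ × ⋯ × C_t`.
Then `id^H(C × Ã) = id^H(A)`. -/
theorem coproduct_algebras_same_identities
    (F : Type) [Field F] [CharZero F] (H : Type) [Ring H] [HopfAlgebra F H]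
    [FiniteDimensional F H] [IsSemisimpleRing H]
    (p : ℕ × ℕ) (r m t : ℕ)
    (hatA : Fin r → FDHMA F H) (tA : Fin m → FDHMA F H) (R : Fin t → FDHMA F H)
    (hhat_basic : ∀ i, IsHBasic F H (hatA i))
    (hhat_index : ∀ i, kemerIndex F H ((hatA i).ids F H) = p)
    (htA_basic : ∀ k, IsHBasic F H (tA k))
    (htA_lower : ∀ k, toLex (kemerIndex F H ((tA k).ids F H)) < toLex p)
    (hRss : ∀ j, IsSemisimpleRing (R j).carrier)
    -- the semisimple part of each `Â_i` is (`H`-equivariantly) one of the `R_j`: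
    (jdx : Fin r → Fin t)
    (ψ : ∀ i, (R (jdx i)).carrier →ₐ[F] (hatA i).carrier)
    (hψinj : ∀ i, Function.Injective (ψ i))
    (hψequiv : ∀ i (h : H) (x : (R (jdx i)).carrier),
      ψ i ((R (jdx i)).M.act h x) = (hatA i).M.act h (ψ i x))
    (hψcompl : ∀ i, IsCompl (Subalgebra.toSubmodule (ψ i).range)
      (jacRad F (hatA i).carrier))
    (hall : ∀ j : Fin t, ∃ i, jdx i = j)
    -- `s - 1` bounds the nilpotency indices:
    (s : ℕ) (hs : ∀ i, nilIndex (hatA i).carrier ≤ s)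
    -- the coproducts `R_j ∗ F^H⟨x₁,...,x_s⟩` with their `H`-structure:
    (CD : ∀ j : Fin t, HCoprodData F H ((R j).carrier) s)
    (hactS : ∀ j (h : H) (x : (R j).carrier),
      (CD j).M'.act h ((CD j).inclS x) = (CD j).inclS ((R j).M.act h x))
    (hactX : ∀ j (h k : H) (q : Fin s →₀ F),
      (CD j).M'.act h ((CD j).inclX (TensorAlgebra.ι F (q ⊗ₜ[F] k)))
        = (CD j).inclX (TensorAlgebra.ι F (q ⊗ₜ[F] (h * k))))
    -- the ideals defining `C_j`:
    (I₁ : ∀ j : Fin t, Submodule F (CD j).B')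
    (hI₁ : ∀ j, I₁ j = hIdealSpan F H (CD j).M'
      {y | ∃ f ∈ (⋂ i, (hatA i).ids F H) ∩ (⋂ k, (tA k).ids F H),
        ∃ v : ℕ → (CD j).B', y = (CD j).M'.eval F H v f})
    (I₂ : ∀ j : Fin t, Submodule F (CD j).B')
    (hI₂ : ∀ j, I₂ j = hIdealSpan F H (CD j).M'
      {y | ∃ (i : Fin s) (h : H), y = (CD j).inclX (xvar F H i h)})
    -- `C_j` is the quotient of the coproduct by `I₁ + I₂^s`:
    (QD : ∀ j : Fin t, HQuotData F H (CD j).B' (CD j).M' (I₁ j ⊔ (I₂ j) ^ s)) :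
    (⋂ j : Fin t, (QD j).N.idSet F H ℕ) ∩ (⋂ k, (tA k).ids F H)
      = (⋂ i, (hatA i).ids F H) ∩ (⋂ k, (tA k).ids F H) := by
  ext f
  simp only [Set.mem_inter_iff, Set.mem_iInter]
  constructor
  · rintro ⟨hf, hf2⟩
    refine ⟨fun i => ?_, hf2⟩
    have : FiniteDimensional F (hatA i).carrier := (hatA i).fd
    refine key (R (jdx i)).M (hatA i).M (ψ i) (hψequiv i) (hψcompl i) (hs i) (CD (jdx i))
      (hactS _) (hactX _) _ (fun g hg => Set.mem_iInter.1 hg.1 i) _ _ (hI₁ _) (hI₂ _) f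
      (fun w => ?_)
    rw [← (QD (jdx i)).ker_eq,
      HMA.map_eval (CD (jdx i)).M' (QD (jdx i)).N (QD (jdx i)).π (QD (jdx i)).equivariant]
    exact hf (jdx i) _
  · rintro ⟨hf, hf2⟩
    refine ⟨fun j v => ?_, hf2⟩
    have h1 : ∀ n, ∃ y, (QD j).π y = v n := fun n => (QD j).surj (v n)
    choose w hw using h1
    have h2 : (QD j).π ∘ w = v := funext hw
    rw [← h2, ← HMA.map_eval (CD j).M' (QD j).N (QD j).π (QD j).equivariant, (QD j).ker_eq]
    apply Submodule.mem_sup_left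
    rw [hI₁]
    apply subset_hIdealSpan
    exact ⟨f, ⟨Set.mem_iInter.2 hf, Set.mem_iInter.2 hf2⟩, w, rfl⟩
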